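/- arXiv:0904.1641 — 2 statements merged into one kernel-verified Lean document; each statement's English description precedes it below -/
import Mathlib

section
/- For all real a, b with 0 < a ≤ b < 1, (1/5)·∫_a^b f(-q)^5 / (f(-q^5)·q) dq = log R(b) − log R(a). -/
open MeasureTheory Real

/-- Euler's product `f(-q) = ∏_{n=1}^∞ (1 - qⁿ)`. -/
noncomputable def eulerF (q : ℝ) : ℝ := ∏' n : ℕ, (1 - q ^ (n + 1))

/-- `y(q) = f(-q^{1/5}) / (q^{1/5} · f(-q⁵))`. -/
noncomputable def yF (q : ℝ) : ℝ :=
  eulerF (q ^ ((1 : ℝ) / 5)) / (q ^ ((1 : ℝ) / 5) * eulerF (q ^ 5))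

/-- The Rogers–Ramanujan continued fraction, recovered from `y(q)` via
`1/R - 1 - R = y`, `0 < R < 1`. -/
noncomputable def RRcf (q : ℝ) : ℝ :=
  (Real.sqrt (yF q ^ 2 + 2 * yF q + 5) - yF q - 1) / 2

open Filter Topology

/-- Gaussian-type sums over `ℤ` with polynomial weights converge. -/
lemma summable_abs_pow_mul_rpow_quadratic {q : ℝ} (hq : 0 < q) (hq1 : q < 1) {α : ℝ} (hα : 0 < α)
    (β γ : ℝ) (k : ℕ) :
    Summable fun n : ℤ ↦ |(n : ℝ)| ^ k * q ^ (α * (n : ℝ) ^ 2 + β * n + γ) := by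
  have hl : Real.log q < 0 := Real.log_neg hq hq1
  have hT : 0 < -(α * Real.log q) / π := by
    apply div_pos _ pi_pos
    nlinarith
  have h := (summable_pow_mul_jacobiTheta₂_term_bound (|β| * |Real.log q| / (2 * π)) hT k).mul_left
    (q ^ γ)
  refine Summable.of_nonneg_of_le (fun n ↦ by positivity) (fun n ↦ ?_) h
  rw [mul_left_comm]
  push_cast
  gcongr
  rw [Real.rpow_add hq, mul_comm (q ^ γ)]
  gcongr
  rw [Real.rpow_def_of_pos hq, Real.exp_le_exp]
  have h1 : Real.log q * (β * n) ≤ |β| * |Real.log q| * |(n : ℝ)| := by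
    calc _ ≤ |Real.log q * (β * n)| := le_abs_self _
      _ = _ := by rw [abs_mul, abs_mul]; ring
  have h2 : -π * (-(α * Real.log q) / π * (n : ℝ) ^ 2
      - 2 * (|β| * |Real.log q| / (2 * π)) * |(n : ℝ)|)
      = Real.log q * (α * (n : ℝ) ^ 2) + |β| * |Real.log q| * |(n : ℝ)| := by
    field_simp
    ring
  rw [h2]
  linarith

/-- The finite product `∏_{i=1}^N (1 - q^i)`. -/
noncomputable def qFact (q : ℝ) (N : ℕ) : ℝ := ∏ i ∈ Finset.range N, (1 - q ^ (i + 1))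

/-- The inverse of `qFact`, extended by zero to negative integers. -/
noncomputable def invQFact (q : ℝ) (m : ℤ) : ℝ := if m < 0 then 0 else (qFact q m.toNat)⁻¹

lemma one_sub_pow_pos {q : ℝ} (hq : 0 < q) (hq1 : q < 1) (i : ℕ) : 0 < 1 - q ^ (i + 1) :=
  sub_pos.2 (pow_lt_one₀ hq.le hq1 (Nat.succ_ne_zero i))

lemma qFact_pos {q : ℝ} (hq : 0 < q) (hq1 : q < 1) (N : ℕ) : 0 < qFact q N :=
  Finset.prod_pos fun i _ ↦ one_sub_pow_pos hq hq1 i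

lemma invQFact_sub_one {q : ℝ} (hq : 0 < q) (hq1 : q < 1) (m : ℤ) :
    invQFact q (m - 1) = (1 - q ^ m) * invQFact q m := by
  rcases lt_trichotomy m 0 with h | rfl | h
  · rw [invQFact, invQFact, if_pos (by omega), if_pos h, mul_zero]
  · simp [invQFact]
  · obtain ⟨k, rfl⟩ : ∃ k : ℕ, m = k + 1 := ⟨(m - 1).toNat, by omega⟩
    rw [invQFact, invQFact, if_neg (by omega), if_neg (by omega)]
    have h1 : ((k : ℤ) + 1 - 1).toNat = k := by omega
    have h2 : ((k : ℤ) + 1).toNat = k + 1 := by omega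
    have h3 : q ^ ((k : ℤ) + 1) = q ^ (k + 1) := by exact_mod_cast zpow_natCast q (k + 1)
    have h4 := (one_sub_pow_pos hq hq1 k).ne'
    have h5 := (qFact_pos hq hq1 k).ne'
    rw [h1, h2, h3, qFact, qFact, Finset.prod_range_succ, ← qFact]
    field_simp

/-- The coefficients of the finite Jacobi triple product. -/
noncomputable def jacobiCoeff (q : ℝ) (N : ℕ) (n : ℤ) : ℝ :=
  qFact q (2 * N) * invQFact q (N - n) * invQFact q (N + n)

lemma jacobiCoeff_succ {q : ℝ} (hq : 0 < q) (hq1 : q < 1) (N : ℕ) (n : ℤ) :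
    jacobiCoeff q (N + 1) n = jacobiCoeff q N n * (1 + q ^ (2 * N + 1))
      + q ^ ((N : ℤ) - n + 1) * jacobiCoeff q N (n - 1)
      + q ^ ((N : ℤ) + 1 + n) * jacobiCoeff q N (n + 1) := by
  have hq0 := hq.ne'
  have e1 : invQFact q (N - n) = (1 - q ^ ((N : ℤ) - n + 1)) * invQFact q (N - n + 1) := by
    rw [← invQFact_sub_one hq hq1]; congr 1; ring
  have e2 : invQFact q (N + n) = (1 - q ^ ((N : ℤ) + 1 + n)) * invQFact q (N + 1 + n) := by
    rw [← invQFact_sub_one hq hq1]; congr 1; ring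
  have e3 : invQFact q (N - (n + 1)) = (1 - q ^ ((N : ℤ) - n)) * invQFact q (N - n) := by
    rw [← invQFact_sub_one hq hq1]; congr 1; ring
  have e4 : invQFact q (N + (n - 1)) = (1 - q ^ ((N : ℤ) + n)) * invQFact q (N + n) := by
    rw [← invQFact_sub_one hq hq1]; congr 1; ring
  have f1 : q ^ ((N : ℤ) - n + 1) = q ^ ((N : ℤ) - n) * q := zpow_add_one₀ hq0 _
  have f2 : q ^ ((N : ℤ) + 1 + n) = q ^ ((N : ℤ) + n) * q := by
    rw [← zpow_add_one₀ hq0]; congr 1; ring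
  have f3 : q ^ (2 * N) = q ^ ((N : ℤ) - n) * q ^ ((N : ℤ) + n) := by
    rw [← zpow_add₀ hq0, ← zpow_natCast]; congr 1; push_cast; ring
  have hF : qFact q (2 * (N + 1)) = qFact q (2 * N) * (1 - q ^ (2 * N) * q)
      * (1 - q ^ (2 * N) * q ^ 2) := by
    rw [show 2 * (N + 1) = 2 * N + 1 + 1 by ring, qFact, Finset.prod_range_succ,
      Finset.prod_range_succ, ← qFact]
    ring
  have g1 : ((N + 1 : ℕ) : ℤ) - n = N - n + 1 := by push_cast; ring
  have g2 : ((N + 1 : ℕ) : ℤ) + n = N + 1 + n := by push_cast; ring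
  have g3 : (N : ℤ) - (n - 1) = N - n + 1 := by ring
  have g4 : (N : ℤ) + (n + 1) = N + 1 + n := by ring
  rw [jacobiCoeff, jacobiCoeff, jacobiCoeff, jacobiCoeff, g1, g2, g3, g4, e3, e4, e1, e2, hF,
    pow_succ q (2 * N), f1, f2, f3]
  ring

/-- The terms of the finite Jacobi triple product at `x = q ^ s`. -/
noncomputable def jacobiTerm (q s : ℝ) (N : ℕ) (n : ℤ) : ℝ :=
  (-1) ^ n * q ^ (((n : ℝ) ^ 2 - n) / 2 + s * n) * jacobiCoeff q N n

lemma jacobiTerm_succ {q : ℝ} (hq : 0 < q) (hq1 : q < 1) (s : ℝ) (N : ℕ) (n : ℤ) :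
    jacobiTerm q s (N + 1) n = (1 + q ^ (2 * N + 1)) * jacobiTerm q s N n
      - q ^ (N + s) * jacobiTerm q s N (n - 1) - q ^ (N + 1 - s) * jacobiTerm q s N (n + 1) := by
  have h1 : q ^ (N + s) * q ^ ((((n - 1 : ℤ) : ℝ) ^ 2 - (n - 1 : ℤ)) / 2 + s * (n - 1 : ℤ))
      = q ^ (((n : ℝ) ^ 2 - n) / 2 + s * n) * q ^ ((N : ℤ) - n + 1) := by
    rw [← Real.rpow_intCast, ← Real.rpow_add hq, ← Real.rpow_add hq]
    congr 1; push_cast; ring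
  have h2 : q ^ (N + 1 - s) * q ^ ((((n + 1 : ℤ) : ℝ) ^ 2 - (n + 1 : ℤ)) / 2 + s * (n + 1 : ℤ))
      = q ^ (((n : ℝ) ^ 2 - n) / 2 + s * n) * q ^ ((N : ℤ) + 1 + n) := by
    rw [← Real.rpow_intCast, ← Real.rpow_add hq, ← Real.rpow_add hq]
    congr 1; push_cast; ring
  have s1 : (-1 : ℝ) ^ (n - 1) = -(-1) ^ n := by
    rw [zpow_sub_one₀ (by norm_num)]; norm_num
  have s2 : (-1 : ℝ) ^ (n + 1) = -(-1) ^ n := by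
    rw [zpow_add_one₀ (by norm_num)]; norm_num
  simp only [jacobiTerm, jacobiCoeff_succ hq hq1, s1, s2]
  linear_combination (-(-1) ^ n * jacobiCoeff q N (n - 1)) * h1
    + (-(-1) ^ n * jacobiCoeff q N (n + 1)) * h2

lemma jacobiTerm_zero_of_ne {q s : ℝ} {n : ℤ} (hn : n ≠ 0) : jacobiTerm q s 0 n = 0 := by
  rcases lt_or_gt_of_ne hn with h | h
  · simp [jacobiTerm, jacobiCoeff, invQFact, h]
  · simp [jacobiTerm, jacobiCoeff, invQFact, h]

lemma jacobiTerm_zero_zero (q s : ℝ) : jacobiTerm q s 0 0 = 1 := by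
  simp [jacobiTerm, jacobiCoeff, invQFact, qFact]

/-- The finite Jacobi triple product. -/
lemma hasSum_jacobiTerm {q : ℝ} (hq : 0 < q) (hq1 : q < 1) (s : ℝ) (N : ℕ) :
    HasSum (jacobiTerm q s N)
      (∏ k ∈ Finset.range N, ((1 - q ^ (k + s)) * (1 - q ^ (k + 1 - s)))) := by
  induction N with
  | zero =>
    have h := hasSum_single (f := jacobiTerm q s 0) 0 fun n hn ↦ jacobiTerm_zero_of_ne hn
    simpa [jacobiTerm_zero_zero] using h
  | succ N ih =>
    have h1 := (Equiv.subRight (1 : ℤ)).hasSum_iff.2 ih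
    have h2 := (Equiv.addRight (1 : ℤ)).hasSum_iff.2 ih
    have h := ((ih.mul_left (1 + q ^ (2 * N + 1))).sub (h1.mul_left (q ^ (N + s)))).sub
      (h2.mul_left (q ^ (N + 1 - s)))
    have hm : q ^ (N + s) * q ^ (N + 1 - s) = q ^ (2 * N + 1) := by
      rw [← Real.rpow_add hq, ← Real.rpow_natCast]
      congr 1; push_cast; ring
    rw [Finset.prod_range_succ]
    convert! h using 1
    · funext n
      exact jacobiTerm_succ hq hq1 s N n
    · rw [← hm]; ring

/-- The derivative at `x = 1` of the finite Jacobi triple product. -/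
lemma hasSum_mul_jacobiTerm {q : ℝ} (hq : 0 < q) (hq1 : q < 1) (N : ℕ) :
    HasSum (fun n : ℤ ↦ n * jacobiTerm q 0 (N + 1) n) (-(qFact q N * qFact q (N + 1))) := by
  have key : ∀ N : ℕ, ∀ S T : ℝ, HasSum (jacobiTerm q 0 N) S →
      HasSum (fun n : ℤ ↦ n * jacobiTerm q 0 N n) T →
      HasSum (fun n : ℤ ↦ n * jacobiTerm q 0 (N + 1) n)
        ((1 + q ^ (2 * N + 1)) * T - q ^ N * (T + S) - q ^ (N + 1) * (T - S)) := by
    intro N S T hS hT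
    have h1 := (Equiv.subRight (1 : ℤ)).hasSum_iff.2 (hT.add hS)
    have h2 := (Equiv.addRight (1 : ℤ)).hasSum_iff.2 (hT.sub hS)
    have h := ((hT.mul_left (1 + q ^ (2 * N + 1))).sub (h1.mul_left (q ^ N))).sub
      (h2.mul_left (q ^ (N + 1)))
    convert! h using 1
    funext n
    have e1 : q ^ ((N : ℝ) + 0) = q ^ N := by rw [add_zero, Real.rpow_natCast]
    have e2 : q ^ ((N : ℝ) + 1 - 0) = q ^ (N + 1) := by
      rw [sub_zero, ← Real.rpow_natCast]; push_cast; rfl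
    rw [jacobiTerm_succ hq hq1, e1, e2]
    simp only [Function.comp_apply, Equiv.subRight_apply, Equiv.coe_addRight]
    push_cast
    ring
  induction N with
  | zero =>
    have h0 : HasSum (fun n : ℤ ↦ n * jacobiTerm q 0 0 n) 0 := by
      convert! hasSum_zero using 1
      funext n
      by_cases hn : n = 0
      · simp [hn]
      · simp [jacobiTerm_zero_of_ne hn]
    convert! key 0 _ _ (hasSum_jacobiTerm hq hq1 0 0) h0 using 1
    simp [qFact]
    ring
  | succ N ih =>
    convert! key (N + 1) _ _ (hasSum_jacobiTerm hq hq1 0 (N + 1)) ih using 1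
    rw [Finset.prod_range_succ']
    simp only [qFact, Finset.prod_range_succ]
    simp
    ring

/-- The infinite product `∏_{k ≥ 0} (1 - q^(k+s))`. -/
noncomputable def qPoch (q s : ℝ) : ℝ := ∏' k : ℕ, (1 - q ^ (k + s))

lemma summable_rpow_natCast_add {q : ℝ} (hq : 0 < q) (hq1 : q < 1) (s : ℝ) :
    Summable fun k : ℕ ↦ q ^ (k + s) := by
  have h := (summable_geometric_of_lt_one hq.le hq1).mul_right (q ^ s)
  refine h.congr fun k ↦ ?_
  rw [Real.rpow_add hq, Real.rpow_natCast]

lemma multipliable_qPoch {q : ℝ} (hq : 0 < q) (hq1 : q < 1) (s : ℝ) :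
    Multipliable fun k : ℕ ↦ 1 - q ^ (k + s) := by
  have h := Real.multipliable_one_add_of_summable (summable_rpow_natCast_add hq hq1 s).neg
  simpa [sub_eq_add_neg] using h

lemma qPoch_pos {q : ℝ} (hq : 0 < q) (hq1 : q < 1) {s : ℝ} (hs : 0 < s) : 0 < qPoch q s := by
  have h := Real.summable_log_one_add_of_summable (summable_rpow_natCast_add hq hq1 s).neg
  have hp : ∀ k : ℕ, 0 < 1 - q ^ (k + s) := fun k ↦
    sub_pos.2 (Real.rpow_lt_one hq.le hq1 (by positivity))
  rw [qPoch, ← Real.rexp_tsum_eq_tprod hp (by simpa [sub_eq_add_neg] using h)]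
  exact Real.exp_pos _

lemma eulerF_eq_qPoch (q : ℝ) : eulerF q = qPoch q 1 := by
  refine tprod_congr fun k ↦ ?_
  rw [← Real.rpow_natCast]; push_cast; rfl

lemma eulerF_pos {q : ℝ} (hq : 0 < q) (hq1 : q < 1) : 0 < eulerF q := by
  rw [eulerF_eq_qPoch]; exact qPoch_pos hq hq1 one_pos

lemma tendsto_qFact {q : ℝ} (hq : 0 < q) (hq1 : q < 1) :
    Tendsto (qFact q) atTop (𝓝 (eulerF q)) := by
  have h := (multipliable_qPoch hq hq1 1).tendsto_prod_tprod_nat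
  rw [← qPoch, ← eulerF_eq_qPoch] at h
  refine h.congr fun N ↦ Finset.prod_congr rfl fun k _ ↦ ?_
  rw [← Real.rpow_natCast]; push_cast; rfl

lemma antitone_qFact {q : ℝ} (hq : 0 < q) (hq1 : q < 1) : Antitone (qFact q) := by
  refine antitone_nat_of_succ_le fun N ↦ ?_
  rw [qFact, Finset.prod_range_succ, ← qFact]
  exact mul_le_of_le_one_right (qFact_pos hq hq1 N).le (by simp; positivity)

lemma eulerF_le_qFact {q : ℝ} (hq : 0 < q) (hq1 : q < 1) (N : ℕ) : eulerF q ≤ qFact q N :=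
  (antitone_qFact hq hq1).le_of_tendsto (tendsto_qFact hq hq1) N

lemma invQFact_nonneg {q : ℝ} (hq : 0 < q) (hq1 : q < 1) (m : ℤ) : 0 ≤ invQFact q m := by
  rw [invQFact]
  split_ifs
  · exact le_rfl
  · exact (inv_pos.2 (qFact_pos hq hq1 _)).le

lemma invQFact_le {q : ℝ} (hq : 0 < q) (hq1 : q < 1) (m : ℤ) :
    invQFact q m ≤ (eulerF q)⁻¹ := by
  have h := eulerF_pos hq hq1
  rw [invQFact]
  split_ifs
  · positivity
  · exact inv_anti₀ h (eulerF_le_qFact hq hq1 _)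

lemma tendsto_invQFact {q : ℝ} (hq : 0 < q) (hq1 : q < 1) :
    Tendsto (invQFact q) atTop (𝓝 (eulerF q)⁻¹) := by
  have hn : Tendsto Int.toNat atTop atTop := tendsto_atTop.2 fun b ↦ by
    filter_upwards [eventually_ge_atTop (b : ℤ)] with m hm
    omega
  have h := ((tendsto_qFact hq hq1).inv₀ (eulerF_pos hq hq1).ne').comp hn
  refine h.congr' ?_
  filter_upwards [eventually_ge_atTop 0] with m hm
  simp [invQFact, not_lt.2 hm]

lemma tendsto_jacobiCoeff {q : ℝ} (hq : 0 < q) (hq1 : q < 1) (n : ℤ) :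
    Tendsto (jacobiCoeff q · n) atTop (𝓝 (eulerF q)⁻¹) := by
  have h0 : Tendsto (fun N : ℕ ↦ 2 * N) atTop atTop :=
    tendsto_id.const_mul_atTop' (by norm_num)
  have h1 : Tendsto (fun N : ℕ ↦ (N : ℤ) - n) atTop atTop :=
    tendsto_atTop_add_const_right _ (-n) tendsto_natCast_atTop_atTop
  have h2 : Tendsto (fun N : ℕ ↦ (N : ℤ) + n) atTop atTop :=
    tendsto_atTop_add_const_right _ n tendsto_natCast_atTop_atTop
  have h := (((tendsto_qFact hq hq1).comp h0).mul ((tendsto_invQFact hq hq1).comp h1)).mul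
    ((tendsto_invQFact hq hq1).comp h2)
  rwa [mul_inv_cancel₀ (eulerF_pos hq hq1).ne', one_mul] at h

lemma abs_jacobiCoeff_le {q : ℝ} (hq : 0 < q) (hq1 : q < 1) (N : ℕ) (n : ℤ) :
    |jacobiCoeff q N n| ≤ (eulerF q)⁻¹ * (eulerF q)⁻¹ := by
  have hE := eulerF_pos hq hq1
  have h0 := invQFact_nonneg hq hq1
  have h1 : qFact q (2 * N) ≤ 1 := by
    simpa [qFact] using antitone_qFact hq hq1 (Nat.zero_le (2 * N))
  have h2 := (qFact_pos hq hq1 (2 * N)).le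
  rw [jacobiCoeff, abs_of_nonneg (mul_nonneg (mul_nonneg h2 (h0 _)) (h0 _))]
  have h3 : qFact q (2 * N) * invQFact q (N - n) ≤ 1 * (eulerF q)⁻¹ :=
    mul_le_mul h1 (invQFact_le hq hq1 _) (h0 _) zero_le_one
  rw [one_mul] at h3
  exact mul_le_mul h3 (invQFact_le hq hq1 _) (h0 _) (by positivity)

/-- Passage to the limit in the finite triple product, with polynomial weights. -/
lemma tendsto_tsum_jacobiTerm {q : ℝ} (hq : 0 < q) (hq1 : q < 1) (s : ℝ) (k : ℕ) :
    Tendsto (fun N ↦ ∑' n : ℤ, (n : ℝ) ^ k * jacobiTerm q s N n) atTop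
      (𝓝 (∑' n : ℤ, (n : ℝ) ^ k * ((-1) ^ n * q ^ (((n : ℝ) ^ 2 - n) / 2 + s * n)
        * (eulerF q)⁻¹))) := by
  have hs := (summable_abs_pow_mul_rpow_quadratic hq hq1 (α := 1 / 2) (by norm_num)
    (s - 1 / 2) 0 k).mul_right ((eulerF q)⁻¹ * (eulerF q)⁻¹)
  refine tendsto_tsum_of_dominated_convergence hs (fun n ↦ ?_) (Eventually.of_forall fun N n ↦ ?_)
  · exact ((tendsto_jacobiCoeff hq hq1 n).const_mul _).const_mul _
  · rw [jacobiTerm, norm_mul, norm_mul, norm_mul, norm_pow, Real.norm_eq_abs, Real.norm_eq_abs,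
      Real.norm_eq_abs, Real.norm_eq_abs, abs_neg_one_zpow, one_mul,
      abs_of_pos (Real.rpow_pos_of_pos hq _), mul_assoc]
    rw [show ((n : ℝ) ^ 2 - n) / 2 + s * n = 1 / 2 * (n : ℝ) ^ 2 + (s - 1 / 2) * n + 0 by ring]
    gcongr
    exact abs_jacobiCoeff_le hq hq1 N n

/-- **Jacobi triple product identity** for real parameters. -/
theorem jacobi_triple_product {q : ℝ} (hq : 0 < q) (hq1 : q < 1) (s : ℝ) :
    ∑' n : ℤ, (-1) ^ n * q ^ (((n : ℝ) ^ 2 - n) / 2 + s * n)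
      = eulerF q * (qPoch q s * qPoch q (1 - s)) := by
  have h := tendsto_tsum_jacobiTerm hq hq1 s 0
  simp only [pow_zero, one_mul, (hasSum_jacobiTerm hq hq1 s _).tsum_eq, tsum_mul_right] at h
  have h1 := (multipliable_qPoch hq hq1 s).tendsto_prod_tprod_nat.mul
    (multipliable_qPoch hq hq1 (1 - s)).tendsto_prod_tprod_nat
  simp only [← Finset.prod_mul_distrib, ← add_sub_assoc] at h1
  have h2 := tendsto_nhds_unique h h1
  have hE := (eulerF_pos hq hq1).ne'
  simp only [qPoch, ← add_sub_assoc]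
  rw [← h2]
  field_simp

/-- Jacobi's identity for the cube of Euler's product. -/
theorem eulerF_pow_three {q : ℝ} (hq : 0 < q) (hq1 : q < 1) :
    ∑' n : ℤ, n * ((-1) ^ n * q ^ (((n : ℝ) ^ 2 - n) / 2)) = -eulerF q ^ 3 := by
  have h := (tendsto_tsum_jacobiTerm hq hq1 0 1).comp (tendsto_add_atTop_nat 1)
  have h1 := ((tendsto_qFact hq hq1).mul
    ((tendsto_qFact hq hq1).comp (tendsto_add_atTop_nat 1))).neg
  have h2 := tendsto_nhds_unique h (h1.congr fun N ↦ by
    simp only [Function.comp_apply, pow_one]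
    exact (hasSum_mul_jacobiTerm hq hq1 N).tsum_eq.symm)
  simp only [pow_one, ← mul_assoc, tsum_mul_right, zero_mul, add_zero] at h2
  have hE := (eulerF_pos hq hq1).ne'
  simp only [← mul_assoc]
  rw [← div_eq_mul_inv, div_eq_iff hE] at h2
  linarith

lemma qPoch_residue {q : ℝ} (hq : 0 < q) (hq1 : q < 1) (m : ℕ) [NeZero m] (s : ℝ) :
    qPoch q s = ∏ r : Fin m, qPoch (q ^ m) ((r + s) / m) := by
  have hm : (m : ℝ) ≠ 0 := NeZero.ne _
  have hqm : 0 < q ^ m := pow_pos hq m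
  have hqm1 : q ^ m < 1 := pow_lt_one₀ hq.le hq1 (NeZero.ne m)
  have h1 : Tendsto (fun N ↦ ∏ k ∈ Finset.range (m * N), (1 - q ^ (k + s))) atTop
      (𝓝 (qPoch q s)) :=
    (multipliable_qPoch hq hq1 s).tendsto_prod_tprod_nat.comp
      (tendsto_id.const_mul_atTop' (Nat.pos_of_ne_zero (NeZero.ne m)))
  have h2 := tendsto_finsetProd Finset.univ fun (r : Fin m) _ ↦
    (multipliable_qPoch hqm hqm1 ((r + s) / m)).tendsto_prod_tprod_nat
  refine tendsto_nhds_unique h1 (h2.congr fun N ↦ ?_)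
  change (∏ r : Fin m, ∏ k ∈ Finset.range N, (1 - (q ^ m) ^ ((k : ℝ) + (r + s) / m))) = _
  rw [Finset.prod_comm]
  induction N with
  | zero => simp
  | succ N ih =>
    rw [Finset.prod_range_succ, ih, mul_add, mul_one, Finset.prod_range_add]
    refine congrArg₂ _ rfl ?_
    rw [Finset.prod_range]
    refine Finset.prod_congr rfl fun r _ ↦ ?_
    rw [← Real.rpow_natCast, ← Real.rpow_mul hq.le]
    congr 2
    push_cast
    field_simp
    ring

lemma tsum_eq_sum_tsum_of_bijective {ι β γ : Type*} [Fintype ι] {f : γ → ℝ} (hf : Summable f)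
    {e : ι × β → γ} (he : Function.Bijective e) :
    ∑' x, f x = ∑ i, ∑' b, f (e (i, b)) := by
  have hs : Summable fun z ↦ f (e z) := (Equiv.ofBijective e he).summable_iff.2 hf
  rw [← (Equiv.ofBijective e he).tsum_eq f, ← tsum_fintype (L := .unconditional _)]
  exact hs.tsum_prod

/-- Sums over `ℤ × ℤ` are invariant under affine unimodular substitutions. -/
lemma tsum_eq_of_affine {F G : ℤ × ℤ → ℝ} (a b c d s t : ℤ) (hdet : (a * d - b * c) ^ 2 = 1)
    (hFG : ∀ u v, F (u, v) = G (a * u + b * v + s, c * u + d * v + t)) :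
    ∑' p, F p = ∑' p, G p := by
  set δ := a * d - b * c with hδ
  let e : ℤ × ℤ ≃ ℤ × ℤ :=
    { toFun := fun p ↦ (a * p.1 + b * p.2 + s, c * p.1 + d * p.2 + t)
      invFun := fun p ↦ (δ * (d * (p.1 - s) - b * (p.2 - t)), δ * (a * (p.2 - t) - c * (p.1 - s)))
      left_inv := fun p ↦ by
        ext
        · simp only; linear_combination p.1 * hdet + δ * p.1 * hδ
        · simp only; linear_combination p.2 * hdet + δ * p.2 * hδ
      right_inv := fun p ↦ by
        ext
        · simp only; linear_combination (p.1 - s) * hdet + δ * (p.1 - s) * hδ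
        · simp only; linear_combination (p.2 - t) * hdet + δ * (p.2 - t) * hδ }
  rw [← e.tsum_eq G]
  exact tsum_congr fun p ↦ hFG p.1 p.2

/-- Splitting a sum over `ℤ × ℤ` according to the parity of the sum of the indices. -/
lemma tsum_parity {F : ℤ × ℤ → ℝ} (hF : Summable F) :
    ∑' p, F p = ∑' p : ℤ × ℤ, F (p.1 + p.2, p.1 - p.2)
      + ∑' p : ℤ × ℤ, F (p.1 + p.2 + 1, p.1 - p.2) := by
  have he : Function.Bijective fun z : Fin 2 × ℤ × ℤ ↦
      (z.2.1 + z.2.2 + (z.1 : ℤ), z.2.1 - z.2.2) := by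
    constructor
    · rintro ⟨i, u, v⟩ ⟨j, u', v'⟩ h
      simp only [Prod.mk.injEq] at h ⊢
      have hi := i.isLt
      have hj := j.isLt
      refine ⟨Fin.ext ?_, ?_, ?_⟩ <;> omega
    · rintro ⟨m, n⟩
      refine ⟨(⟨((m + n) % 2).toNat, by omega⟩, (m + n) / 2, (m + n) / 2 - n), ?_⟩
      ext <;> simp only <;> omega
  rw [tsum_eq_sum_tsum_of_bijective hF he, Fin.sum_univ_two]
  simp

/-- Splitting a sum over `ℤ × ℤ` according to the parities of both indices. -/
lemma tsum_parity_parity {F : ℤ × ℤ → ℝ} (hF : Summable F) :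
    ∑' p, F p = ∑' p : ℤ × ℤ, F (2 * p.1, 2 * p.2) + ∑' p : ℤ × ℤ, F (2 * p.1, 2 * p.2 + 1)
      + (∑' p : ℤ × ℤ, F (2 * p.1 + 1, 2 * p.2) + ∑' p : ℤ × ℤ, F (2 * p.1 + 1, 2 * p.2 + 1)) := by
  have he : Function.Bijective fun z : (Fin 2 × Fin 2) × ℤ × ℤ ↦
      (2 * z.2.1 + (z.1.1 : ℤ), 2 * z.2.2 + (z.1.2 : ℤ)) := by
    constructor
    · rintro ⟨⟨i, j⟩, u, v⟩ ⟨⟨i', j'⟩, u', v'⟩ h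
      simp only [Prod.mk.injEq] at h ⊢
      have hi := i.isLt
      have hi' := i'.isLt
      have hj := j.isLt
      have hj' := j'.isLt
      refine ⟨⟨Fin.ext ?_, Fin.ext ?_⟩, ?_, ?_⟩ <;> omega
    · rintro ⟨m, n⟩
      refine ⟨((⟨(m % 2).toNat, by omega⟩, ⟨(n % 2).toNat, by omega⟩), m / 2, n / 2), ?_⟩
      ext <;> simp only <;> omega
  rw [tsum_eq_sum_tsum_of_bijective hF he, Fintype.sum_prod_type, Fin.sum_univ_two]
  simp

/-- Splitting a sum over `ℤ × ℤ` according to the residue of `k - 2 * l` modulo five. -/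
lemma tsum_mod_five {F : ℤ × ℤ → ℝ} (hF : Summable F) :
    ∑' p, F p = ∑ r : Fin 5, ∑' p : ℤ × ℤ, F (2 * p.2 + (r : ℤ) + 5 * p.1, p.2) := by
  have he : Function.Bijective fun z : Fin 5 × ℤ × ℤ ↦
      (2 * z.2.2 + (z.1 : ℤ) + 5 * z.2.1, z.2.2) := by
    constructor
    · rintro ⟨i, u, v⟩ ⟨j, u', v'⟩ h
      simp only [Prod.mk.injEq] at h ⊢
      have hi := i.isLt
      have hj := j.isLt
      refine ⟨Fin.ext ?_, ?_, ?_⟩ <;> omega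
    · rintro ⟨m, n⟩
      refine ⟨(⟨((m - 2 * n) % 5).toNat, by omega⟩, (m - 2 * n) / 5, n), ?_⟩
      ext <;> simp only
      omega
  exact tsum_eq_sum_tsum_of_bijective hF he

/-- The terms of an alternating unary theta series. -/
noncomputable def gaussTerm (q c a b : ℝ) (n : ℤ) : ℝ := (-1) ^ n * q ^ (c * (a * n + b) ^ 2)

lemma summable_pow_mul_rpow_sq {q : ℝ} (hq : 0 < q) (hq1 : q < 1) {c a : ℝ} (hc : 0 < c)
    (ha : a ≠ 0) (b : ℝ) (k : ℕ) :
    Summable fun n : ℤ ↦ |(n : ℝ)| ^ k * q ^ (c * (a * n + b) ^ 2) := by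
  have ha2 : 0 < c * a ^ 2 := by positivity
  refine (summable_abs_pow_mul_rpow_quadratic hq hq1 ha2 (2 * c * a * b) (c * b ^ 2) k).congr
    fun n ↦ ?_
  congr 2; ring

lemma summable_norm_sq_mul_rpow_sq {q : ℝ} (hq : 0 < q) (hq1 : q < 1) {c a : ℝ} (hc : 0 < c)
    (ha : a ≠ 0) (b : ℝ) :
    Summable fun n : ℤ ↦ (a * n + b) ^ 2 * q ^ (c * (a * n + b) ^ 2) := by
  have h := ((summable_pow_mul_rpow_sq hq hq1 hc ha b 2).mul_left (2 * a ^ 2)).add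
    ((summable_pow_mul_rpow_sq hq hq1 hc ha b 0).mul_left (2 * b ^ 2))
  refine Summable.of_nonneg_of_le (fun n ↦ by positivity) (fun n ↦ ?_) h
  rw [sq_abs, pow_zero, one_mul, ← mul_assoc, ← add_mul]
  gcongr
  nlinarith [sq_nonneg (a * n - b)]

lemma summable_norm_weighted_rpow_sq {q : ℝ} (hq : 0 < q) (hq1 : q < 1) {c a : ℝ} (hc : 0 < c)
    (ha : a ≠ 0) (b : ℝ) {w : ℤ → ℝ} (hw : ∀ n, |w n| ≤ 1 + (a * n + b) ^ 2) :
    Summable fun n : ℤ ↦ ‖w n * q ^ (c * (a * n + b) ^ 2)‖ := by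
  have h := (summable_pow_mul_rpow_sq hq hq1 hc ha b 0).add
    (summable_norm_sq_mul_rpow_sq hq hq1 hc ha b)
  refine Summable.of_nonneg_of_le (fun n ↦ norm_nonneg _) (fun n ↦ ?_) h
  rw [pow_zero, ← add_mul, norm_mul, Real.norm_eq_abs, Real.norm_eq_abs,
    abs_of_pos (Real.rpow_pos_of_pos hq _)]
  gcongr
  exact hw n

lemma summable_norm_gaussTerm {q : ℝ} (hq : 0 < q) (hq1 : q < 1) {c a : ℝ} (hc : 0 < c)
    (ha : a ≠ 0) (b : ℝ) : Summable fun n ↦ ‖gaussTerm q c a b n‖ :=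
  summable_norm_weighted_rpow_sq hq hq1 hc ha b fun n ↦ by
    rw [abs_neg_one_zpow]; nlinarith [sq_nonneg (a * n + b)]

lemma summable_norm_sq_mul_gaussTerm {q : ℝ} (hq : 0 < q) (hq1 : q < 1) {c a : ℝ} (hc : 0 < c)
    (ha : a ≠ 0) (b : ℝ) : Summable fun n : ℤ ↦ ‖(a * n + b) ^ 2 * gaussTerm q c a b n‖ := by
  refine (summable_norm_weighted_rpow_sq hq hq1 hc ha b
    (w := fun n ↦ (a * n + b) ^ 2 * (-1) ^ n) fun n ↦ ?_).congr fun n ↦ ?_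
  · rw [abs_mul, abs_neg_one_zpow, mul_one, abs_of_nonneg (by positivity)]; linarith
  · rw [gaussTerm, mul_assoc]

lemma gaussTerm_mul {q : ℝ} (hq : 0 < q) (c a b c' a' b' : ℝ) (m n : ℤ) :
    gaussTerm q c a b m * gaussTerm q c' a' b' n
      = (-1) ^ (m + n) * q ^ (c * (a * m + b) ^ 2 + c' * (a' * n + b') ^ 2) := by
  rw [gaussTerm, gaussTerm, zpow_add₀ (by norm_num), Real.rpow_add hq]
  ring

lemma neg_one_zpow_of_even_sub {m n : ℤ} (h : Even (m - n)) : (-1 : ℝ) ^ m = (-1) ^ n := by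
  rw [show m = m - n + n by ring, zpow_add₀ (by norm_num), h.neg_one_zpow, one_mul]

lemma neg_one_zpow_of_odd_sub {m n : ℤ} (h : Odd (m - n)) : (-1 : ℝ) ^ m = -(-1) ^ n := by
  rw [show m = m - n + n by ring, zpow_add₀ (by norm_num), h.neg_one_zpow, neg_one_mul]

/-- The theta series `q^(9/40) ∑ (-1)^n q^((5n²-3n)/2)`. -/
noncomputable def thetaU (q : ℝ) : ℝ := ∑' n, gaussTerm q (1 / 40) 10 (-3) n

/-- The theta series `q^(1/40) ∑ (-1)^n q^((5n²-n)/2)`. -/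
noncomputable def thetaV (q : ℝ) : ℝ := ∑' n, gaussTerm q (1 / 40) 10 (-1) n

lemma tsum_gaussTerm_eq_product {q : ℝ} (hq : 0 < q) (hq1 : q < 1) (c a b s : ℝ) (m : ℕ)
    (hm : m ≠ 0) (hca : 2 * c * a ^ 2 = m) (hs : 2 * c * a * b = m * (s - 1 / 2)) :
    ∑' n, gaussTerm q c a b n
      = q ^ (c * b ^ 2) * (eulerF (q ^ m) * (qPoch (q ^ m) s * qPoch (q ^ m) (1 - s))) := by
  rw [← jacobi_triple_product (pow_pos hq m) (pow_lt_one₀ hq.le hq1 hm), ← tsum_mul_left]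
  refine tsum_congr fun n ↦ ?_
  rw [gaussTerm, ← Real.rpow_natCast q m, ← Real.rpow_mul hq.le, mul_left_comm, ← Real.rpow_add hq]
  congr 2
  linear_combination ((n : ℝ) ^ 2 / 2) * hca + n * hs

/-- Euler's pentagonal number theorem. -/
lemma eulerF_eq_tsum {q : ℝ} (hq : 0 < q) (hq1 : q < 1) :
    q ^ (1 / 24 : ℝ) * eulerF q = ∑' n, gaussTerm q (1 / 24) 6 1 n := by
  rw [tsum_gaussTerm_eq_product hq hq1 _ _ _ (2 / 3) 3 (by norm_num) (by norm_num) (by norm_num),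
    eulerF_eq_qPoch q, qPoch_residue hq hq1 3, Fin.prod_univ_three, eulerF_eq_qPoch]
  norm_num
  left
  ring

lemma thetaU_eq_product {q : ℝ} (hq : 0 < q) (hq1 : q < 1) :
    thetaU q = q ^ (9 / 40 : ℝ)
      * (eulerF (q ^ 5) * (qPoch (q ^ 5) (1 / 5) * qPoch (q ^ 5) (4 / 5))) := by
  rw [thetaU, tsum_gaussTerm_eq_product hq hq1 _ _ _ (1 / 5) 5 (by norm_num) (by norm_num)
    (by norm_num)]
  norm_num

lemma thetaV_eq_product {q : ℝ} (hq : 0 < q) (hq1 : q < 1) :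
    thetaV q = q ^ (1 / 40 : ℝ)
      * (eulerF (q ^ 5) * (qPoch (q ^ 5) (2 / 5) * qPoch (q ^ 5) (3 / 5))) := by
  rw [thetaV, tsum_gaussTerm_eq_product hq hq1 _ _ _ (2 / 5) 5 (by norm_num) (by norm_num)
    (by norm_num)]
  norm_num

lemma thetaU_pos {q : ℝ} (hq : 0 < q) (hq1 : q < 1) : 0 < thetaU q := by
  have h5 : 0 < q ^ 5 := pow_pos hq 5
  have h51 : q ^ 5 < 1 := pow_lt_one₀ hq.le hq1 (by norm_num)
  rw [thetaU_eq_product hq hq1]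
  have h1 := qPoch_pos h5 h51 (s := 1 / 5) (by norm_num)
  have h2 := qPoch_pos h5 h51 (s := 4 / 5) (by norm_num)
  have h3 := eulerF_pos h5 h51
  positivity

lemma thetaV_pos {q : ℝ} (hq : 0 < q) (hq1 : q < 1) : 0 < thetaV q := by
  have h5 : 0 < q ^ 5 := pow_pos hq 5
  have h51 : q ^ 5 < 1 := pow_lt_one₀ hq.le hq1 (by norm_num)
  rw [thetaV_eq_product hq hq1]
  have h1 := qPoch_pos h5 h51 (s := 2 / 5) (by norm_num)
  have h2 := qPoch_pos h5 h51 (s := 3 / 5) (by norm_num)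
  have h3 := eulerF_pos h5 h51
  positivity

lemma thetaU_mul_thetaV {q : ℝ} (hq : 0 < q) (hq1 : q < 1) :
    thetaU q * thetaV q = q ^ (1 / 4 : ℝ) * (eulerF q * eulerF (q ^ 5)) := by
  have hpow : q ^ (1 / 4 : ℝ) = q ^ (9 / 40 : ℝ) * q ^ (1 / 40 : ℝ) := by
    rw [← Real.rpow_add hq]; norm_num
  have hE : eulerF q = qPoch (q ^ 5) (1 / 5) * qPoch (q ^ 5) (2 / 5) * qPoch (q ^ 5) (3 / 5)
      * qPoch (q ^ 5) (4 / 5) * eulerF (q ^ 5) := by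
    rw [eulerF_eq_qPoch q, qPoch_residue hq hq1 5, Fin.prod_univ_five, eulerF_eq_qPoch]
    norm_num
  rw [thetaU_eq_product hq hq1, thetaV_eq_product hq hq1, hpow, hE]
  ring

lemma eulerF_pow_five_eq_tsum {q : ℝ} (hq : 0 < q) (hq1 : q < 1) :
    q ^ (5 / 24 : ℝ) * eulerF (q ^ 5) = ∑' n, gaussTerm q (1 / 120) 30 5 n := by
  have h := eulerF_eq_tsum (pow_pos hq 5) (pow_lt_one₀ hq.le hq1 (by norm_num : 5 ≠ 0))
  rw [← Real.rpow_natCast q 5, ← Real.rpow_mul hq.le] at h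
  rw [show (5 / 24 : ℝ) = (5 : ℕ) * (1 / 24) by norm_num, ← Real.rpow_natCast q 5, h]
  refine tsum_congr fun n ↦ ?_
  rw [gaussTerm, gaussTerm, ← Real.rpow_mul hq.le]
  congr 2
  push_cast
  ring

/-- The five-dissection of Euler's product. -/
lemma eulerF_dissection {q : ℝ} (hq : 0 < q) (hq1 : q < 1) :
    q ^ (1 / 120 : ℝ) * eulerF (q ^ (1 / 5 : ℝ))
      = (∑' n, gaussTerm q (1 / 120) 30 1 n - ∑' n, gaussTerm q (1 / 120) 30 19 n)
        - q ^ (5 / 24 : ℝ) * eulerF (q ^ 5)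
        - (∑' n, gaussTerm q (1 / 120) 30 7 n - ∑' n, gaussTerm q (1 / 120) 30 13 n) := by
  have h := eulerF_eq_tsum (Real.rpow_pos_of_pos hq (1 / 5))
    (Real.rpow_lt_one hq.le hq1 (by norm_num))
  rw [← Real.rpow_mul hq.le, show (1 / 5 * (1 / 24) : ℝ) = 1 / 120 by norm_num] at h
  have h' : ∑' n, gaussTerm (q ^ (1 / 5 : ℝ)) (1 / 24) 6 1 n
      = ∑' n, gaussTerm q (1 / 120) 6 1 n := tsum_congr fun n ↦ by
    rw [gaussTerm, gaussTerm, ← Real.rpow_mul hq.le]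
    congr 2
    ring
  have he : Function.Bijective fun z : Fin 5 × ℤ ↦ 5 * z.2 + (z.1 : ℤ) := by
    constructor
    · rintro ⟨i, u⟩ ⟨j, u'⟩ h
      simp only [Prod.mk.injEq] at h ⊢
      have hi := i.isLt
      have hj := j.isLt
      refine ⟨Fin.ext ?_, ?_⟩ <;> omega
    · intro n
      refine ⟨(⟨(n % 5).toNat, by omega⟩, n / 5), ?_⟩
      simp only
      omega
  have hs := (summable_norm_gaussTerm hq hq1 (c := 1 / 120) (a := 6) (by norm_num) (by norm_num)
    1).of_norm
  rw [h, h', tsum_eq_sum_tsum_of_bijective hs he, Fin.sum_univ_five, eulerF_pow_five_eq_tsum hq hq1]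
  have e0 (n : ℤ) : gaussTerm q (1 / 120) 6 1 (5 * n + ((0 : Fin 5) : ℕ))
      = gaussTerm q (1 / 120) 30 1 n := by
    rw [gaussTerm, gaussTerm, neg_one_zpow_of_even_sub (n := n) ⟨2 * n, by simp; ring⟩]
    congr 2; push_cast; simp; ring
  have e1 (n : ℤ) : gaussTerm q (1 / 120) 6 1 (5 * n + ((1 : Fin 5) : ℕ))
      = -gaussTerm q (1 / 120) 30 7 n := by
    rw [gaussTerm, gaussTerm, neg_one_zpow_of_odd_sub (n := n) ⟨2 * n, by simp; ring⟩, neg_mul]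
    congr 3; push_cast; simp; ring
  have e2 (n : ℤ) : gaussTerm q (1 / 120) 6 1 (5 * n + ((2 : Fin 5) : ℕ))
      = gaussTerm q (1 / 120) 30 13 n := by
    rw [gaussTerm, gaussTerm, neg_one_zpow_of_even_sub (n := n) ⟨2 * n + 1, by simp; ring⟩]
    congr 2; push_cast; simp; ring
  have e3 (n : ℤ) : gaussTerm q (1 / 120) 6 1 (5 * n + ((3 : Fin 5) : ℕ))
      = -gaussTerm q (1 / 120) 30 19 n := by
    rw [gaussTerm, gaussTerm, neg_one_zpow_of_odd_sub (n := n) ⟨2 * n + 1, by simp; ring⟩, neg_mul]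
    congr 3; push_cast; simp; ring
  have e4 (n : ℤ) : gaussTerm q (1 / 120) 6 1 (5 * n + ((4 : Fin 5) : ℕ))
      = -gaussTerm q (1 / 120) 30 5 (-1 - n) := by
    rw [gaussTerm, gaussTerm, neg_one_zpow_of_odd_sub (n := -1 - n) ⟨3 * n + 2, by simp; ring⟩,
      neg_mul]
    congr 3; push_cast; simp; ring
  simp only [e0, e1, e2, e3, e4, tsum_neg]
  have h5 : ∑' n : ℤ, gaussTerm q (1 / 120) 30 5 (-1 - n) = ∑' n, gaussTerm q (1 / 120) 30 5 n :=
    (Equiv.subLeft (-1 : ℤ)).tsum_eq (gaussTerm q (1 / 120) 30 5)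
  rw [h5]
  ring

/-- Matching of the terms of two products of theta series with equal signs. -/
lemma gaussTerm_mul_eq {q : ℝ} (hq : 0 < q) {c a b c' a' b' d f g d' f' g' : ℝ} {m n k l : ℤ}
    (hs : Even (m + n - (k + l)))
    (hx : c * (a * m + b) ^ 2 + c' * (a' * n + b') ^ 2
      = d * (f * k + g) ^ 2 + d' * (f' * l + g') ^ 2) :
    gaussTerm q c a b m * gaussTerm q c' a' b' n
      = gaussTerm q d f g k * gaussTerm q d' f' g' l := by
  rw [gaussTerm_mul hq, gaussTerm_mul hq, hx, neg_one_zpow_of_even_sub hs]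

lemma gaussTerm_mul_eq_neg {q : ℝ} (hq : 0 < q) {c a b c' a' b' d f g d' f' g' : ℝ} {m n k l : ℤ}
    (hs : Odd (m + n - (k + l)))
    (hx : c * (a * m + b) ^ 2 + c' * (a' * n + b') ^ 2
      = d * (f * k + g) ^ 2 + d' * (f' * l + g') ^ 2) :
    gaussTerm q c a b m * gaussTerm q c' a' b' n
      = -(gaussTerm q d f g k * gaussTerm q d' f' g' l) := by
  rw [gaussTerm_mul hq, gaussTerm_mul hq, hx, neg_one_zpow_of_odd_sub hs, neg_mul]

lemma gaussTerm_mul_eq_tsum {q : ℝ} (hq : 0 < q) (hq1 : q < 1) {c a b c' a' b' : ℝ} (hc : 0 < c)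
    (ha : a ≠ 0) (hc' : 0 < c') (ha' : a' ≠ 0) :
    (∑' n, gaussTerm q c a b n) * ∑' n, gaussTerm q c' a' b' n
      = ∑' p : ℤ × ℤ, gaussTerm q c a b (p.1 + p.2) * gaussTerm q c' a' b' (p.1 - p.2)
        + ∑' p : ℤ × ℤ, gaussTerm q c a b (p.1 + p.2 + 1) * gaussTerm q c' a' b' (p.1 - p.2) := by
  have h1 := summable_norm_gaussTerm hq hq1 hc ha b
  have h2 := summable_norm_gaussTerm hq hq1 hc' ha' b'
  rw [tsum_mul_tsum_of_summable_norm h1 h2, tsum_parity (summable_mul_of_summable_norm h1 h2)]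

/-- A quintuple product identity in bilinear form. -/
lemma dissection_mul_thetaU {q : ℝ} (hq : 0 < q) (hq1 : q < 1) :
    (∑' n, gaussTerm q (1 / 120) 30 1 n - ∑' n, gaussTerm q (1 / 120) 30 19 n) * thetaU q
      = q ^ (5 / 24 : ℝ) * eulerF (q ^ 5) * thetaV q := by
  rw [eulerF_pow_five_eq_tsum hq hq1, sub_mul, thetaU, thetaV,
    gaussTerm_mul_eq_tsum hq hq1 (by norm_num) (by norm_num) (by norm_num) (by norm_num),
    gaussTerm_mul_eq_tsum hq hq1 (by norm_num) (by norm_num) (by norm_num) (by norm_num),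
    gaussTerm_mul_eq_tsum hq hq1 (by norm_num) (by norm_num) (by norm_num) (by norm_num)]
  have h1 : ∑' p : ℤ × ℤ, gaussTerm q (1 / 120) 30 1 (p.1 + p.2)
        * gaussTerm q (1 / 40) 10 (-3) (p.1 - p.2)
      = ∑' p : ℤ × ℤ, gaussTerm q (1 / 120) 30 5 (p.1 + p.2)
        * gaussTerm q (1 / 40) 10 (-1) (p.1 - p.2) :=
    tsum_eq_of_affine 1 1 (-1) 0 0 0 (by norm_num) fun u v ↦
      gaussTerm_mul_eq hq (by grind) (by push_cast; ring)
  have h2 : ∑' p : ℤ × ℤ, gaussTerm q (1 / 120) 30 1 (p.1 + p.2 + 1)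
        * gaussTerm q (1 / 40) 10 (-3) (p.1 - p.2)
      = ∑' p : ℤ × ℤ, gaussTerm q (1 / 120) 30 19 (p.1 + p.2 + 1)
        * gaussTerm q (1 / 40) 10 (-3) (p.1 - p.2) :=
    tsum_eq_of_affine 0 1 (-1) (-1) 0 (-2) (by norm_num) fun u v ↦
      gaussTerm_mul_eq hq (by grind) (by push_cast; ring)
  have h3 : ∑' p : ℤ × ℤ, gaussTerm q (1 / 120) 30 19 (p.1 + p.2)
        * gaussTerm q (1 / 40) 10 (-3) (p.1 - p.2)
      = -∑' p : ℤ × ℤ, gaussTerm q (1 / 120) 30 5 (p.1 + p.2 + 1)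
        * gaussTerm q (1 / 40) 10 (-1) (p.1 - p.2) := by
    rw [← tsum_neg]
    exact tsum_eq_of_affine 0 (-1) 1 1 (-1) 0 (by norm_num) fun u v ↦
      gaussTerm_mul_eq_neg hq (by grind) (by push_cast; ring)
  linarith

/-- A quintuple product identity in bilinear form. -/
lemma dissection_mul_thetaV {q : ℝ} (hq : 0 < q) (hq1 : q < 1) :
    (∑' n, gaussTerm q (1 / 120) 30 7 n - ∑' n, gaussTerm q (1 / 120) 30 13 n) * thetaV q
      = q ^ (5 / 24 : ℝ) * eulerF (q ^ 5) * thetaU q := by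
  rw [eulerF_pow_five_eq_tsum hq hq1, sub_mul, thetaU, thetaV,
    gaussTerm_mul_eq_tsum hq hq1 (by norm_num) (by norm_num) (by norm_num) (by norm_num),
    gaussTerm_mul_eq_tsum hq hq1 (by norm_num) (by norm_num) (by norm_num) (by norm_num),
    gaussTerm_mul_eq_tsum hq hq1 (by norm_num) (by norm_num) (by norm_num) (by norm_num)]
  have h1 : ∑' p : ℤ × ℤ, gaussTerm q (1 / 120) 30 7 (p.1 + p.2)
        * gaussTerm q (1 / 40) 10 (-1) (p.1 - p.2)
      = ∑' p : ℤ × ℤ, gaussTerm q (1 / 120) 30 5 (p.1 + p.2)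
        * gaussTerm q (1 / 40) 10 (-3) (p.1 - p.2) :=
    tsum_eq_of_affine (-1) 0 1 1 0 0 (by norm_num) fun u v ↦
      gaussTerm_mul_eq hq (by grind) (by push_cast; ring)
  have h2 : ∑' p : ℤ × ℤ, gaussTerm q (1 / 120) 30 7 (p.1 + p.2 + 1)
        * gaussTerm q (1 / 40) 10 (-1) (p.1 - p.2)
      = ∑' p : ℤ × ℤ, gaussTerm q (1 / 120) 30 13 (p.1 + p.2 + 1)
        * gaussTerm q (1 / 40) 10 (-1) (p.1 - p.2) :=
    tsum_eq_of_affine 0 1 (-1) (-1) 0 (-2) (by norm_num) fun u v ↦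
      gaussTerm_mul_eq hq (by grind) (by push_cast; ring)
  have h3 : ∑' p : ℤ × ℤ, gaussTerm q (1 / 120) 30 13 (p.1 + p.2)
        * gaussTerm q (1 / 40) 10 (-1) (p.1 - p.2)
      = -∑' p : ℤ × ℤ, gaussTerm q (1 / 120) 30 5 (p.1 + p.2 + 1)
        * gaussTerm q (1 / 40) 10 (-3) (p.1 - p.2) := by
    rw [← tsum_neg]
    exact tsum_eq_of_affine 1 1 0 (-1) 0 (-1) (by norm_num) fun u v ↦
      gaussTerm_mul_eq_neg hq (by grind) (by push_cast; ring)
  linarith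

/-- The Rogers–Ramanujan continued fraction as a quotient of theta series. -/
lemma RRcf_eq_thetaU_div_thetaV {q : ℝ} (hq : 0 < q) (hq1 : q < 1) :
    RRcf q = thetaU q / thetaV q := by
  have hU := thetaU_pos hq hq1
  have hV := thetaV_pos hq hq1
  have hE : 0 < eulerF (q ^ 5) := eulerF_pos (pow_pos hq 5) (pow_lt_one₀ hq.le hq1 (by norm_num))
  have h120 : 0 < q ^ (1 / 120 : ℝ) := rpow_pos_of_pos hq _
  have h15 : 0 < q ^ (1 / 5 : ℝ) := rpow_pos_of_pos hq _
  have hpow : q ^ (5 / 24 : ℝ) = q ^ (1 / 120 : ℝ) * q ^ (1 / 5 : ℝ) := by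
    rw [← rpow_add hq]; norm_num
  have hA := dissection_mul_thetaU hq hq1
  have hB := dissection_mul_thetaV hq hq1
  have hD := eulerF_dissection hq hq1
  rw [hpow] at hA hB hD
  have hy : yF q = thetaV q / thetaU q - 1 - thetaU q / thetaV q := by
    rw [yF]
    field_simp
    refine mul_left_cancel₀ h120.ne' ?_
    linear_combination thetaU q * thetaV q * hD + thetaV q * hA - thetaU q * hB
  have hsq : yF q ^ 2 + 2 * yF q + 5 = (thetaV q / thetaU q + thetaU q / thetaV q) ^ 2 := by
    rw [hy]; field_simp; ring
  rw [RRcf, hsq, sqrt_sq (by positivity), hy]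
  ring

/-- Jacobi's series for the cube of Euler's product. -/
lemma tsum_mul_rpow_sq_eq_eulerF_pow_three {q : ℝ} (hq : 0 < q) (hq1 : q < 1) :
    ∑' k : ℤ, (4 * k + 1 : ℝ) * q ^ (1 / 8 * (4 * k + 1 : ℝ) ^ 2)
      = q ^ (1 / 8 : ℝ) * eulerF q ^ 3 := by
  have he : Function.Bijective fun z : Fin 2 × ℤ ↦
      if z.1 = 0 then -2 * z.2 else 2 * z.2 + 1 := by
    constructor
    · rintro ⟨i, u⟩ ⟨j, v⟩ h
      fin_cases i <;> fin_cases j <;> simp at h ⊢ <;> omega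
    · intro n
      rcases Int.even_or_odd' n with ⟨k, rfl | rfl⟩
      · exact ⟨(0, -k), by simp⟩
      · exact ⟨(1, k), by simp⟩
  have hs : Summable fun n : ℤ ↦ (n : ℝ) * ((-1) ^ n * q ^ (((n : ℝ) ^ 2 - n) / 2)) := by
    refine Summable.of_norm ((summable_abs_pow_mul_rpow_quadratic hq hq1 (α := 1 / 2) (by norm_num)
      (-1 / 2) 0 1).congr fun n ↦ ?_)
    rw [norm_mul, norm_mul, norm_eq_abs, norm_eq_abs, norm_eq_abs, abs_neg_one_zpow, one_mul,
      abs_of_pos (rpow_pos_of_pos hq _), pow_one]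
    congr 2
    ring
  have h := eulerF_pow_three hq hq1
  have hs1 := (hs.comp_injective (i := fun k : ℤ ↦ -2 * k) fun x y ↦ by simp)
  have hs2 := (hs.comp_injective (i := fun k : ℤ ↦ 2 * k + 1) fun x y ↦ by simp)
  rw [tsum_eq_sum_tsum_of_bijective hs he, Fin.sum_univ_two] at h
  simp only [↓reduceIte, one_ne_zero] at h
  replace h := (Summable.tsum_add hs1 hs2).trans h
  simp only [Function.comp_apply] at h
  rw [← neg_eq_iff_eq_neg.2 h, ← tsum_neg, ← tsum_mul_left]
  refine tsum_congr fun k ↦ ?_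
  rw [Even.neg_one_zpow ⟨-k, by ring⟩, Odd.neg_one_zpow ⟨k, rfl⟩,
    show 1 / 8 * (4 * k + 1 : ℝ) ^ 2 = 1 / 8 + (((-2 * k : ℤ) : ℝ) ^ 2 - (-2 * k : ℤ)) / 2 by
      push_cast; ring, rpow_add hq,
    show ((2 * k + 1 : ℤ) : ℝ) ^ 2 - (2 * k + 1 : ℤ) = ((-2 * k : ℤ) : ℝ) ^ 2 - (-2 * k : ℤ) by
      push_cast; ring]
  push_cast
  ring

/-- The terms of the product of two theta series weighted by `3 c ^ 2 - 3 d ^ 2 + 8 c d`. -/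
noncomputable def weightedTerm (q : ℝ) (p : ℤ × ℤ) : ℝ :=
  (3 * (4 * p.1 + 1 : ℝ) ^ 2 - 3 * (4 * p.2 + 1 : ℝ) ^ 2 + 8 * (4 * p.1 + 1) * (4 * p.2 + 1))
    * q ^ (1 / 8 * ((4 * p.1 + 1 : ℝ) ^ 2 + (4 * p.2 + 1 : ℝ) ^ 2))

lemma weightedTerm_eq {q : ℝ} (hq : 0 < q) (p : ℤ × ℤ) :
    weightedTerm q p
      = 3 * (((4 * p.1 + 1 : ℝ) ^ 2 * q ^ (1 / 8 * (4 * p.1 + 1 : ℝ) ^ 2))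
          * (1 * q ^ (1 / 8 * (4 * p.2 + 1 : ℝ) ^ 2)))
        - 3 * ((1 * q ^ (1 / 8 * (4 * p.1 + 1 : ℝ) ^ 2))
          * ((4 * p.2 + 1 : ℝ) ^ 2 * q ^ (1 / 8 * (4 * p.2 + 1 : ℝ) ^ 2)))
        + 8 * (((4 * p.1 + 1 : ℝ) * q ^ (1 / 8 * (4 * p.1 + 1 : ℝ) ^ 2))
          * ((4 * p.2 + 1 : ℝ) * q ^ (1 / 8 * (4 * p.2 + 1 : ℝ) ^ 2))) := by
  rw [weightedTerm, mul_add (1 / 8 : ℝ), rpow_add hq]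
  ring

lemma hasSum_weightedTerm {q : ℝ} (hq : 0 < q) (hq1 : q < 1) :
    HasSum (weightedTerm q) (8 * (q ^ (1 / 8 : ℝ) * eulerF q ^ 3) ^ 2) := by
  have hw {w : ℤ → ℝ} (h : ∀ n : ℤ, |w n| ≤ 1 + (4 * n + 1 : ℝ) ^ 2) :=
    summable_norm_weighted_rpow_sq hq hq1 (c := 1 / 8) (a := 4) (by norm_num) (by norm_num) 1 h
  have h0 := hw (w := fun _ ↦ 1) fun n ↦ by rw [abs_one]; nlinarith [sq_nonneg (4 * n + 1 : ℝ)]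
  have h1 := hw (w := fun n ↦ 4 * n + 1) fun n ↦ by
    rw [abs_le]; constructor <;> nlinarith [sq_nonneg (4 * n : ℝ), sq_nonneg (4 * n + 2 : ℝ)]
  have h2 := hw (w := fun n ↦ (4 * n + 1) ^ 2) fun n ↦ by
    rw [abs_of_nonneg (by positivity)]; linarith
  have key {f g : ℤ → ℝ} (hf : Summable fun n ↦ ‖f n‖) (hg : Summable fun n ↦ ‖g n‖) :
      HasSum (fun p : ℤ × ℤ ↦ f p.1 * g p.2) ((∑' n, f n) * ∑' n, g n) := by
    rw [tsum_mul_tsum_of_summable_norm hf hg]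
    exact (summable_mul_of_summable_norm hf hg).hasSum
  have h := (((key h2 h0).mul_left 3).sub ((key h0 h2).mul_left 3)).add ((key h1 h1).mul_left 8)
  rw [tsum_mul_rpow_sq_eq_eulerF_pow_three hq hq1] at h
  rw [funext (weightedTerm_eq hq)]
  have e (x y z : ℝ) : 3 * (x * y) - 3 * (y * x) + 8 * (z * z) = 8 * z ^ 2 := by ring
  rwa [e] at h

lemma wronskian_eq {q : ℝ} (hq : 0 < q) (hq1 : q < 1) :
    (∑' n : ℤ, (10 * n + -3 : ℝ) ^ 2 * gaussTerm q (1 / 40) 10 (-3) n) * thetaV q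
        - thetaU q * ∑' n : ℤ, (10 * n + -1 : ℝ) ^ 2 * gaussTerm q (1 / 40) 10 (-1) n
      = 8 * (q ^ (1 / 8 : ℝ) * eulerF q ^ 3) ^ 2 := by
  have hc : (0 : ℝ) < 1 / 40 := by norm_num
  have ha : (10 : ℝ) ≠ 0 := by norm_num
  have hU := summable_norm_gaussTerm hq hq1 hc ha (-3)
  have hV := summable_norm_gaussTerm hq hq1 hc ha (-1)
  have hU2 := summable_norm_sq_mul_gaussTerm hq hq1 hc ha (-3)
  have hV2 := summable_norm_sq_mul_gaussTerm hq hq1 hc ha (-1)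
  have hs1 := summable_mul_of_summable_norm hU2 hV
  have hs2 := summable_mul_of_summable_norm hU hV2
  have hH := hasSum_weightedTerm hq hq1
  rw [← hH.tsum_eq, tsum_mod_five hH.summable, Fin.sum_univ_five, thetaU, thetaV,
    tsum_mul_tsum_of_summable_norm hU2 hV, tsum_mul_tsum_of_summable_norm hU hV2,
    ← hs1.tsum_sub hs2, tsum_parity_parity (hs1.sub hs2)]
  set F : ℤ × ℤ → ℝ := fun p ↦
    (10 * p.1 + -3 : ℝ) ^ 2 * gaussTerm q (1 / 40) 10 (-3) p.1 * gaussTerm q (1 / 40) 10 (-1) p.2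
      - gaussTerm q (1 / 40) 10 (-3) p.1
        * ((10 * p.2 + -1 : ℝ) ^ 2 * gaussTerm q (1 / 40) 10 (-1) p.2)
  have term (m n k l : ℤ) (σ : ℝ) (hσ : (-1) ^ (m + n) = σ)
      (hx : 1 / 40 * (10 * m + -3 : ℝ) ^ 2 + 1 / 40 * (10 * n + -1 : ℝ) ^ 2
        = 1 / 8 * ((4 * k + 1 : ℝ) ^ 2 + (4 * l + 1 : ℝ) ^ 2))
      (hw : σ * ((10 * m + -3 : ℝ) ^ 2 - (10 * n + -1 : ℝ) ^ 2)
        = 3 * (4 * k + 1 : ℝ) ^ 2 - 3 * (4 * l + 1 : ℝ) ^ 2 + 8 * (4 * k + 1) * (4 * l + 1)) :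
      F (m, n) = weightedTerm q (k, l) := by
    rw [weightedTerm, ← hw, ← hx, ← hσ]
    linear_combination ((10 * m + -3 : ℝ) ^ 2 - (10 * n + -1 : ℝ) ^ 2)
      * gaussTerm_mul hq (1 / 40) 10 (-3) (1 / 40) 10 (-1) m n
  have h0 : ∑' p : ℤ × ℤ, F (2 * p.1, 2 * p.2)
      = ∑' p : ℤ × ℤ, weightedTerm q (2 * p.2 + ((0 : Fin 5) : ℕ) + 5 * p.1, p.2) :=
    tsum_eq_of_affine 0 1 (-1) (-2) 0 0 (by norm_num) fun u v ↦ term (2 * u) (2 * v) _ _ 1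
      (Even.neg_one_zpow (by grind)) (by push_cast; simp; ring) (by push_cast; simp; ring)
  have h1 : ∑' p : ℤ × ℤ, F (2 * p.1, 2 * p.2 + 1)
      = ∑' p : ℤ × ℤ, weightedTerm q (2 * p.2 + ((1 : Fin 5) : ℕ) + 5 * p.1, p.2) :=
    tsum_eq_of_affine (-1) 0 2 (-1) 0 (-1) (by norm_num) fun u v ↦ term (2 * u) (2 * v + 1) _ _ (-1)
      (Odd.neg_one_zpow (by grind)) (by push_cast; simp; ring) (by push_cast; simp; ring)
  have h2 : ∑' p : ℤ × ℤ, F (2 * p.1 + 1, 2 * p.2)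
      = ∑' p : ℤ × ℤ, weightedTerm q (2 * p.2 + ((2 : Fin 5) : ℕ) + 5 * p.1, p.2) :=
    tsum_eq_of_affine 1 0 (-2) 1 0 (-1) (by norm_num) fun u v ↦ term (2 * u + 1) (2 * v) _ _ (-1)
      (Odd.neg_one_zpow (by grind)) (by push_cast; simp; ring) (by push_cast; simp; ring)
  have h3 : ∑' p : ℤ × ℤ, F (2 * p.1 + 1, 2 * p.2 + 1)
      = ∑' p : ℤ × ℤ, weightedTerm q (2 * p.2 + ((3 : Fin 5) : ℕ) + 5 * p.1, p.2) :=
    tsum_eq_of_affine 0 (-1) 1 2 (-1) 1 (by norm_num) fun u v ↦ term (2 * u + 1) (2 * v + 1) _ _ 1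
      (Even.neg_one_zpow (by grind)) (by push_cast; simp; ring) (by push_cast; simp; ring)
  have h4 : ∑' p : ℤ × ℤ, weightedTerm q (2 * p.2 + ((4 : Fin 5) : ℕ) + 5 * p.1, p.2)
      = -∑' p : ℤ × ℤ, weightedTerm q (2 * p.2 + ((4 : Fin 5) : ℕ) + 5 * p.1, p.2) := by
    rw [← tsum_neg]
    refine tsum_eq_of_affine 2 1 (-3) (-2) 1 (-3) (by norm_num) fun u v ↦ ?_
    rw [weightedTerm, weightedTerm, ← neg_mul]
    congr 1
    · push_cast; simp; ring
    · congr 1; push_cast; simp; ring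
  rw [h0, h1, h2, h3]
  linarith

lemma hasDerivAt_gaussTerm {q : ℝ} (hq : 0 < q) (c a b : ℝ) (n : ℤ) :
    HasDerivAt (fun z ↦ gaussTerm z c a b n)
      (c / q * ((a * n + b) ^ 2 * gaussTerm q c a b n)) q := by
  refine ((hasDerivAt_rpow_const (p := c * (a * n + b) ^ 2) (Or.inl hq.ne')).const_mul
    ((-1) ^ n)).congr_deriv ?_
  rw [gaussTerm, rpow_sub_one hq.ne']
  ring

/-- Theta series can be differentiated term by term. -/
lemma hasDerivAt_tsum_gaussTerm {q : ℝ} (hq : 0 < q) (hq1 : q < 1) {c a : ℝ} (hc : 0 < c)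
    (ha : a ≠ 0) (b : ℝ) :
    HasDerivAt (fun z ↦ ∑' n, gaussTerm z c a b n)
      (c / q * ∑' n : ℤ, (a * n + b) ^ 2 * gaussTerm q c a b n) q := by
  have hr : 0 < (q + 1) / 2 := by linarith
  have hr1 : (q + 1) / 2 < 1 := by linarith
  have hqt : q ∈ Set.Ioo (q / 2) ((q + 1) / 2) := ⟨by linarith, by linarith⟩
  rw [← tsum_mul_left]
  refine hasDerivAt_tsum_of_isPreconnected
    ((summable_norm_sq_mul_rpow_sq hr hr1 hc ha b).mul_left (c / (q / 2))) isOpen_Ioo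
    isPreconnected_Ioo (fun n y hy ↦ hasDerivAt_gaussTerm (by linarith [hy.1]) c a b n)
    (fun n y hy ↦ ?_) hqt (summable_norm_gaussTerm hq hq1 hc ha b).of_norm hqt
  have hy0 : 0 < y := by linarith [hy.1]
  rw [gaussTerm, norm_mul, norm_mul, norm_mul, norm_eq_abs, norm_eq_abs, norm_eq_abs, norm_eq_abs,
    abs_neg_one_zpow, one_mul, abs_of_pos (div_pos hc hy0), abs_of_nonneg (sq_nonneg _),
    abs_of_pos (rpow_pos_of_pos hy0 _)]
  gcongr
  · exact hy.1.le
  · exact hy.2.le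

/-- The logarithmic derivative of the Rogers–Ramanujan continued fraction. -/
lemma hasDerivAt_log_thetaU_sub_log_thetaV {q : ℝ} (hq : 0 < q) (hq1 : q < 1) :
    HasDerivAt (fun z ↦ log (thetaU z) - log (thetaV z))
      (1 / 5 * (eulerF q ^ 5 / (eulerF (q ^ 5) * q))) q := by
  have hU := thetaU_pos hq hq1
  have hV := thetaV_pos hq hq1
  have hE := eulerF_pos hq hq1
  have hE5 : 0 < eulerF (q ^ 5) := eulerF_pos (pow_pos hq 5) (pow_lt_one₀ hq.le hq1 (by norm_num))
  have hpow : q ^ (1 / 4 : ℝ) = (q ^ (1 / 8 : ℝ)) ^ 2 := by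
    rw [sq, ← rpow_add hq]; norm_num
  have h8 : 0 < q ^ (1 / 8 : ℝ) := rpow_pos_of_pos hq _
  have hUV := thetaU_mul_thetaV hq hq1
  have hW := wronskian_eq hq hq1
  rw [hpow] at hUV
  have hdU : HasDerivAt thetaU _ q :=
    hasDerivAt_tsum_gaussTerm hq hq1 (c := 1 / 40) (a := 10) (by norm_num) (by norm_num) (-3)
  have hdV : HasDerivAt thetaV _ q :=
    hasDerivAt_tsum_gaussTerm hq hq1 (c := 1 / 40) (a := 10) (by norm_num) (by norm_num) (-1)
  refine ((hdU.log hU.ne').sub (hdV.log hV.ne')).congr_deriv ?_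
  rw [div_sub_div _ _ hU.ne' hV.ne', hUV, div_eq_iff (by positivity)]
  field_simp
  linear_combination 5 * hW

lemma log_RRcf {q : ℝ} (hq : 0 < q) (hq1 : q < 1) :
    log (RRcf q) = log (thetaU q) - log (thetaV q) := by
  rw [RRcf_eq_thetaU_div_thetaV hq hq1, log_div (thetaU_pos hq hq1).ne' (thetaV_pos hq hq1).ne']

theorem ramanujan_log_R (a b : ℝ) (ha : 0 < a) (hab : a ≤ b) (hb : b < 1) :
    (1 / 5) * ∫ q in a..b, eulerF q ^ 5 / (eulerF (q ^ 5) * q) =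
      Real.log (RRcf b) - Real.log (RRcf a) := by
  have hd : ∀ q ∈ Set.uIcc a b, HasDerivAt (fun z ↦ log (thetaU z) - log (thetaV z))
      (1 / 5 * (eulerF q ^ 5 / (eulerF (q ^ 5) * q))) q := fun q hq ↦ by
    rw [Set.uIcc_of_le hab] at hq
    exact hasDerivAt_log_thetaU_sub_log_thetaV (ha.trans_le hq.1) (hq.2.trans_lt hb)
  have hint := intervalIntegral.intervalIntegrable_deriv_of_nonneg (HasDerivAt.continuousOn hd)
    (fun q hq ↦ hd q (Set.Ioo_subset_Icc_self hq)) fun q hq ↦ by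
      rw [min_eq_left hab, max_eq_right hab] at hq
      have hq0 : 0 < q := ha.trans hq.1
      have hq1 : q < 1 := hq.2.trans hb
      have hE := eulerF_pos hq0 hq1
      have hE5 : 0 < eulerF (q ^ 5) :=
        eulerF_pos (pow_pos hq0 5) (pow_lt_one₀ hq0.le hq1 (by norm_num))
      positivity
  rw [← intervalIntegral.integral_const_mul, intervalIntegral.integral_eq_sub_of_hasDerivAt hd hint,
    log_RRcf (ha.trans_le hab) hb, log_RRcf ha (hab.trans_lt hb)]
end

section
/- For every real number k and all real numbers a, b with 0 < a ≤ b < 1, ∫_a^b y(q)^k · q^{-4/5} · f(-q)^5 / f(-q^{1/5}) dq = -5·∫_{y(a)}^{y(b)} x^{k-1} / √(5 + 2x + x²) dx (equivalently, = 5·∫_{y(b)}^{y(a)} x^{k-1}/√(5+2x+x²) dx, since y is decreasing). -/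
open MeasureTheory Real

section

open Filter Topology Finset

lemma summable_pow_succ {q : ℝ} (h0 : 0 ≤ q) (h1 : q < 1) : Summable fun n : ℕ ↦ q ^ (n + 1) :=
  (summable_nat_add_iff 1).2 (summable_geometric_of_lt_one h0 h1)

/-- The partial products `∏_{i < n} (1 - q^{i+1})` of Euler's product. -/
noncomputable def eulerPartial (q : ℝ) (n : ℕ) : ℝ := ∏ i ∈ range n, (1 - q ^ (i + 1))

lemma eulerPartial_succ (q : ℝ) (n : ℕ) :
    eulerPartial q (n + 1) = eulerPartial q n * (1 - q ^ (n + 1)) := prod_range_succ _ _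

lemma tendsto_eulerPartial {q : ℝ} (h0 : 0 ≤ q) (h1 : q < 1) :
    Tendsto (eulerPartial q) atTop (𝓝 (eulerF q)) := by
  have h : Multipliable fun n : ℕ ↦ (1 + -q ^ (n + 1)) :=
    Real.multipliable_one_add_of_summable (summable_pow_succ h0 h1).neg
  simpa [eulerF, eulerPartial, sub_eq_add_neg] using! h.hasProd.tendsto_prod_nat

lemma eulerPartial_pos {q : ℝ} (h0 : 0 ≤ q) (h1 : q < 1) (n : ℕ) : 0 < eulerPartial q n :=
  prod_pos fun i _ ↦ sub_pos.2 (pow_lt_one₀ h0 h1 (Nat.succ_ne_zero i))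

lemma eulerPartial_antitone {q : ℝ} (h0 : 0 ≤ q) (h1 : q < 1) : Antitone (eulerPartial q) := by
  refine antitone_nat_of_succ_le fun n ↦ ?_
  rw [eulerPartial_succ]
  exact mul_le_of_le_one_right (eulerPartial_pos h0 h1 n).le (by linarith [pow_nonneg h0 (n + 1)])

lemma eulerF_pos_s17 {q : ℝ} (h0 : 0 ≤ q) (h1 : q < 1) : 0 < eulerF q := by
  refine lt_of_le_of_ne (ge_of_tendsto' (tendsto_eulerPartial h0 h1)
    fun n ↦ (eulerPartial_pos h0 h1 n).le) (Ne.symm ?_)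
  have := tprod_one_add_ne_zero_of_summable (f := fun n : ℕ ↦ -q ^ (n + 1))
    (fun i ↦ by
      have := pow_lt_one₀ h0 h1 (Nat.succ_ne_zero i)
      simp only [Nat.succ_eq_add_one] at this
      linarith)
    (summable_pow_succ h0 h1).neg.norm
  simpa [eulerF, sub_eq_add_neg] using this

lemma eulerF_le_eulerPartial {q : ℝ} (h0 : 0 ≤ q) (h1 : q < 1) (n : ℕ) :
    eulerF q ≤ eulerPartial q n :=
  (eulerPartial_antitone h0 h1).le_of_tendsto (tendsto_eulerPartial h0 h1) n

/-- Gaussian binomial coefficients. -/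
def gaussBinom (q : ℝ) : ℕ → ℕ → ℝ
  | _, 0 => 1
  | 0, _ + 1 => 0
  | n + 1, k + 1 => gaussBinom q n (k + 1) * q ^ (k + 1) + gaussBinom q n k

lemma gaussBinom_eq_zero (q : ℝ) {n k : ℕ} (h : n < k) : gaussBinom q n k = 0 := by
  induction n generalizing k with
  | zero => obtain ⟨k, rfl⟩ := Nat.exists_eq_succ_of_ne_zero h.ne'; rfl
  | succ n ih =>
    obtain ⟨k, rfl⟩ := Nat.exists_eq_succ_of_ne_zero (by lia : k ≠ 0)
    simp [gaussBinom, ih (by lia : n < k + 1), ih (by lia : n < k)]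

lemma gaussBinom_zero_right (q : ℝ) (n : ℕ) : gaussBinom q n 0 = 1 := by
  cases n <;> rfl

lemma gaussBinom_self (q : ℝ) (n : ℕ) : gaussBinom q n n = 1 := by
  induction n with
  | zero => rfl
  | succ n ih => simp [gaussBinom, ih, gaussBinom_eq_zero]

lemma gaussBinom_mul (q : ℝ) (k m : ℕ) :
    gaussBinom q (k + m) k * (eulerPartial q k * eulerPartial q m) = eulerPartial q (k + m) := by
  induction hn : k + m generalizing k m with
  | zero =>
    obtain ⟨rfl, rfl⟩ : k = 0 ∧ m = 0 := by lia
    simp [gaussBinom, eulerPartial]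
  | succ n ih =>
    rcases k with _ | k
    · obtain rfl : m = n + 1 := by lia
      simp [gaussBinom, eulerPartial]
    rcases m with _ | m
    · obtain rfl : k = n := by lia
      simp [gaussBinom_self, eulerPartial]
    have h1 := ih (k + 1) m (by lia)
    have h2 := ih k (m + 1) (by lia)
    have hn' : n = k + m + 1 := by lia
    rw [eulerPartial_succ q n, gaussBinom]
    have e1 := eulerPartial_succ q k
    have e2 := eulerPartial_succ q m
    have e : q ^ (n + 1) = q ^ (k + 1) * q ^ (m + 1) := by rw [← pow_add, hn']; congr 1; lia
    rw [e]
    linear_combination q ^ (k + 1) * (1 - q ^ (m + 1)) * h1 + (1 - q ^ (k + 1)) * h2 +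
      gaussBinom q n (k + 1) * q ^ (k + 1) * eulerPartial q (k + 1) * e2 +
      gaussBinom q n k * eulerPartial q (m + 1) * e1

/-- The `q`-binomial theorem. -/
lemma prod_one_add_mul_pow (q x : ℝ) (n : ℕ) :
    ∏ i ∈ range n, (1 + x * q ^ i) =
      ∑ k ∈ range (n + 1), gaussBinom q n k * q ^ (k.choose 2) * x ^ k := by
  induction n generalizing x with
  | zero => simp [gaussBinom]
  | succ n ih =>
    have h : ∏ i ∈ range n, (1 + x * q ^ (i + 1)) =
        ∑ k ∈ range (n + 1), gaussBinom q n k * q ^ ((k + 1).choose 2) * x ^ k := by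
      simp_rw [pow_succ', ← mul_assoc, ih (x * q)]
      refine sum_congr rfl fun k _ ↦ ?_
      rw [Nat.choose_succ_succ' k 1, Nat.choose_one_right, pow_add, mul_pow]
      ring
    rw [prod_range_succ', h, pow_zero, mul_one, mul_add, mul_one,
      sum_range_succ' (fun k ↦ gaussBinom q (n + 1) k * q ^ (k.choose 2) * x ^ k),
      sum_range_succ' (fun k ↦ gaussBinom q n k * q ^ ((k + 1).choose 2) * x ^ k)]
    have h2 : ∑ k ∈ range n, gaussBinom q n (k + 1) * q ^ ((k + 1 + 1).choose 2) * x ^ (k + 1) =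
        ∑ k ∈ range (n + 1), gaussBinom q n (k + 1) * q ^ ((k + 1 + 1).choose 2) * x ^ (k + 1) := by
      rw [sum_range_succ, gaussBinom_eq_zero q (Nat.lt_succ_self n)]
      simp
    have h3 : (∑ k ∈ range n, gaussBinom q n (k + 1) * q ^ ((k + 1 + 1).choose 2) * x ^ (k + 1) +
        gaussBinom q n 0 * q ^ (Nat.choose (0 + 1) 2) * x ^ 0) * x =
        ∑ k ∈ range (n + 1), gaussBinom q n k * q ^ ((k + 1).choose 2) * x ^ (k + 1) := by
      rw [← sum_range_succ' (fun k ↦ gaussBinom q n k * q ^ ((k + 1).choose 2) * x ^ k), sum_mul]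
      exact sum_congr rfl fun k _ ↦ by ring
    rw [h3, h2, add_right_comm, ← sum_add_distrib]
    congr 1
    · refine sum_congr rfl fun k _ ↦ ?_
      rw [gaussBinom, Nat.choose_succ_succ' (k + 1) 1, Nat.choose_one_right, pow_add]
      ring
    · simp [gaussBinom_zero_right]

lemma gaussBinom_eq_div {q : ℝ} (h0 : 0 ≤ q) (h1 : q < 1) (k m : ℕ) :
    gaussBinom q (k + m) k = eulerPartial q (k + m) / (eulerPartial q k * eulerPartial q m) := by
  rw [eq_div_iff (mul_pos (eulerPartial_pos h0 h1 k) (eulerPartial_pos h0 h1 m)).ne',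
    gaussBinom_mul]

lemma tendsto_sum_gaussBinom_mul {q : ℝ} (h0 : 0 ≤ q) (h1 : q < 1) {F : ℤ → ℝ}
    (hF : Summable F) :
    Tendsto (fun N : ℕ ↦ ∑ k ∈ range (2 * N + 1), gaussBinom q (2 * N) k * F (k - N)) atTop
      (𝓝 (∑' j, (eulerF q)⁻¹ * F j)) := by
  have hf := eulerF_pos_s17 h0 h1
  let c : ℕ → ℤ → ℝ := fun N j ↦
    if -(N : ℤ) ≤ j ∧ j ≤ N then gaussBinom q (2 * N) (j + N).toNat else 0
  have hc (N : ℕ) (j : ℤ) (hj : -(N : ℤ) ≤ j ∧ j ≤ N) : c N j =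
      eulerPartial q (2 * N) / (eulerPartial q (N + j).toNat * eulerPartial q (N - j).toNat) := by
    simp only [c, if_pos hj]
    have e : 2 * N = (N + j).toNat + (N - j).toNat := by lia
    rw [e, add_comm j, gaussBinom_eq_div h0 h1]
  have key : Tendsto (fun N : ℕ ↦ ∑' j, c N j * F j) atTop (𝓝 (∑' j, (eulerF q)⁻¹ * F j)) := by
    refine tendsto_tsum_of_dominated_convergence
      (bound := fun j ↦ (eulerF q * eulerF q)⁻¹ * |F j|) (hF.abs.mul_left _) (fun j ↦ ?_)
      (Eventually.of_forall fun N j ↦ ?_)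
    · refine Tendsto.mul_const _ ?_
      have hev : ∀ᶠ N : ℕ in atTop, eulerPartial q (2 * N) /
          (eulerPartial q (N + j).toNat * eulerPartial q (N - j).toNat) = c N j := by
        filter_upwards [eventually_ge_atTop j.natAbs] with N hN
        exact (hc N j (by lia)).symm
      refine Tendsto.congr' hev ?_
      have ht := tendsto_eulerPartial h0 h1
      have a1 : Tendsto (fun N : ℕ ↦ 2 * N) atTop atTop :=
        tendsto_atTop_mono (fun N ↦ by simp only [id]; lia) tendsto_id
      have a2 : Tendsto (fun N : ℕ ↦ ((N : ℤ) + j).toNat) atTop atTop :=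
        tendsto_atTop_mono (f := fun N : ℕ ↦ N - j.natAbs) (fun N ↦ by lia)
          (tendsto_sub_atTop_nat _)
      have a3 : Tendsto (fun N : ℕ ↦ ((N : ℤ) - j).toNat) atTop atTop :=
        tendsto_atTop_mono (f := fun N : ℕ ↦ N - j.natAbs) (fun N ↦ by lia)
          (tendsto_sub_atTop_nat _)
      have := (ht.comp a1).div ((ht.comp a2).mul (ht.comp a3)) (mul_pos hf hf).ne'
      have e : (eulerF q)⁻¹ = eulerF q / (eulerF q * eulerF q) := by field_simp
      rw [e]
      exact this
    · rw [norm_mul, Real.norm_eq_abs, Real.norm_eq_abs]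
      refine mul_le_mul_of_nonneg_right ?_ (abs_nonneg _)
      by_cases hj : -(N : ℤ) ≤ j ∧ j ≤ N
      · have p1 := eulerPartial_pos h0 h1 (2 * N)
        have p2 := eulerF_le_eulerPartial h0 h1 (N + j).toNat
        have p3 := eulerF_le_eulerPartial h0 h1 (N - j).toNat
        have p4 : eulerPartial q (2 * N) ≤ 1 := by
          simpa [eulerPartial] using eulerPartial_antitone h0 h1 (Nat.zero_le (2 * N))
        have p5 : eulerF q * eulerF q ≤
            eulerPartial q (N + j).toNat * eulerPartial q (N - j).toNat :=
          mul_le_mul p2 p3 hf.le (hf.le.trans p2)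
        have p6 := mul_pos hf hf
        rw [hc N j hj, abs_of_nonneg (div_nonneg p1.le (p6.le.trans p5)), ← one_div]
        exact div_le_div₀ zero_le_one p4 p6 p5
      · simp only [c, if_neg hj, abs_zero]
        positivity
  refine key.congr fun N ↦ ?_
  symm
  rw [tsum_eq_sum (s := (range (2 * N + 1)).image fun k : ℕ ↦ (k : ℤ) - N)]
  · rw [sum_image (fun a _ b _ h ↦ by simpa using h)]
    refine sum_congr rfl fun k hk ↦ ?_
    have hk' := mem_range.1 hk
    simp only [c]
    rw [if_pos (by lia), sub_add_cancel, Int.toNat_natCast]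
  · intro j hj
    have : ¬ (-(N : ℤ) ≤ j ∧ j ≤ N) := fun h ↦ hj <| mem_image.2
      ⟨(j + N).toNat, mem_range.2 (by lia), by lia⟩
    simp [c, this]

/-- The finite Jacobi triple product. -/
lemma prod_one_sub_exp_eq_sum (t s : ℝ) (N : ℕ) :
    ∏ i ∈ range N, ((1 - exp (s + i * t)) * (1 - exp ((i + 1) * t - s))) =
      ∑ k ∈ range (2 * N + 1), gaussBinom (exp t) (2 * N) k * ((-1) ^ ((k : ℤ) - N) *
        exp (t * (((k : ℤ) - N : ℤ) * (((k : ℤ) - N : ℤ) - 1) / 2) + s * ((k : ℤ) - N : ℤ))) := by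
  have h := prod_one_add_mul_pow (exp t) (-exp (s - N * t)) (2 * N)
  have hfac (i : ℕ) : 1 + -exp (s - N * t) * exp t ^ i = 1 - exp (s + (i - N) * t) := by
    rw [← Real.exp_nat_mul, neg_mul, ← Real.exp_add, ← sub_eq_add_neg]
    congr 2; ring
  have hlow : ∏ i ∈ range N, (1 - exp (s + ((i : ℕ) - N) * t)) =
      (-1) ^ N * exp (N * s - t * (N * (N + 1) / 2)) *
        ∏ i ∈ range N, (1 - exp ((i + 1) * t - s)) := by
    have h1 : ∏ i ∈ range N, (1 - exp (s + ((i : ℕ) - N) * t)) =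
        ∏ i ∈ range N, (1 - exp (s - (i + 1) * t)) := by
      rw [← prod_range_reflect]
      refine prod_congr rfl fun i hi ↦ ?_
      have hi' := mem_range.1 hi
      rw [Nat.cast_sub (by lia), Nat.cast_sub (by lia)]
      congr 2; push_cast; ring
    rw [h1]
    clear h1 h hfac
    induction N with
    | zero => simp
    | succ n ih =>
      rw [prod_range_succ, ih, prod_range_succ]
      have e : exp ((n + 1 : ℕ) * s - t * ((n + 1 : ℕ) * ((n + 1 : ℕ) + 1) / 2)) =
          exp (n * s - t * (n * (n + 1) / 2)) * exp (s - (n + 1) * t) := by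
        rw [← Real.exp_add]; congr 1; push_cast; ring
      have e2 : exp (s - (n + 1) * t) * exp ((n + 1) * t - s) = 1 := by
        rw [← Real.exp_add]; simp
      rw [e, pow_succ]
      linear_combination -(-1) ^ n * exp (n * s - t * (n * (n + 1) / 2)) *
        (∏ i ∈ range n, (1 - exp ((i + 1) * t - s))) * e2
  simp_rw [hfac] at h
  rw [two_mul N, prod_range_add, hlow, ← two_mul] at h
  have hhigh : ∏ i ∈ range N, (1 - exp (s + (((N + i : ℕ) : ℝ) - N) * t)) =
      ∏ i ∈ range N, (1 - exp (s + i * t)) :=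
    prod_congr rfl fun i _ ↦ by congr 2; push_cast; ring
  rw [hhigh] at h
  have hinv : ((-1 : ℝ) ^ N * exp (-(N * s - t * (N * (N + 1) / 2)))) *
      ((-1) ^ N * exp (N * s - t * (N * (N + 1) / 2))) = 1 := by
    rw [mul_mul_mul_comm, ← Real.exp_add, ← mul_pow]; simp
  have h' := congrArg
    (fun x ↦ ((-1 : ℝ) ^ N * exp (-(N * s - t * (N * (N + 1) / 2)))) * x) h
  simp only [mul_sum] at h'
  rw [prod_mul_distrib]
  refine Eq.trans ?_ (h'.trans ?_)
  · linear_combination -(∏ i ∈ range N, (1 - exp (s + i * t))) *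
      (∏ i ∈ range N, (1 - exp ((i + 1) * t - s))) * hinv
  · refine sum_congr rfl fun k _ ↦ ?_
    have hs : (-1 : ℝ) ^ ((k : ℤ) - N) = (-1) ^ N * (-1) ^ k := by
      rw [zpow_sub₀ (by norm_num), zpow_natCast, zpow_natCast, div_eq_iff (by simp), mul_right_comm,
        ← mul_pow]
      simp
    have he : exp (t * (((k : ℤ) - N : ℤ) * (((k : ℤ) - N : ℤ) - 1) / 2) + s * ((k : ℤ) - N : ℤ)) =
        exp (-(N * s - t * (N * (N + 1) / 2))) * exp t ^ (k.choose 2) * exp (s - N * t) ^ k := by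
      rw [← Real.exp_nat_mul, ← Real.exp_nat_mul, ← Real.exp_add, ← Real.exp_add,
        Nat.cast_choose_two]
      congr 1; push_cast; ring
    rw [hs, he, neg_pow (exp _) k]
    ring

/-- The theta series `∑ (-1)ⁿ exp((an+b)²t)`. -/
noncomputable def altTheta (a b : ℤ) (t : ℝ) : ℝ :=
  ∑' n : ℤ, (-1) ^ n * exp ((a * n + b) ^ 2 * t)

lemma summable_pow_mul_exp_sq {a : ℤ} (ha : a ≠ 0) (b : ℤ) {t : ℝ} (ht : t < 0) (k : ℕ) :
    Summable fun n : ℤ ↦ (|a * n + b| : ℝ) ^ k * exp ((a * n + b) ^ 2 * t) := by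
  have h := summable_pow_mul_jacobiTheta₂_term_bound 0 (T := -t / π)
    (div_pos (neg_pos.2 ht) pi_pos) k
  have hinj : Function.Injective fun n : ℤ ↦ a * n + b := fun x y h ↦ by
    simpa [ha] using h
  refine (h.comp_injective hinj).congr fun n ↦ ?_
  simp only [Function.comp, Int.cast_add, Int.cast_mul]
  congr 2
  · push_cast; rfl
  · push_cast; field_simp; ring

lemma summable_altTheta {a : ℤ} (ha : a ≠ 0) (b : ℤ) {t : ℝ} (ht : t < 0) :
    Summable fun n : ℤ ↦ ‖(-1 : ℝ) ^ n * exp ((a * n + b) ^ 2 * t)‖ := by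
  refine (summable_pow_mul_exp_sq ha b ht 0).congr fun n ↦ ?_
  simp

lemma tendsto_prod_altTheta {a : ℤ} (ha : a ≠ 0) (b : ℤ) {u : ℝ} (hu : u < 0) :
    Tendsto (fun N : ℕ ↦ ∏ i ∈ range N, ((1 - exp ((2 * a ^ 2 * i + (a ^ 2 + 2 * a * b)) * u)) *
      (1 - exp ((2 * a ^ 2 * i + (a ^ 2 - 2 * a * b)) * u)))) atTop
      (𝓝 ((eulerF (exp (2 * a ^ 2 * u)))⁻¹ * (exp (-b ^ 2 * u) * altTheta a b u))) := by
  have ha' : (0 : ℝ) < a ^ 2 := by positivity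
  have hq : exp (2 * a ^ 2 * u) < 1 := Real.exp_lt_one_iff.2 (by nlinarith)
  have h := tendsto_sum_gaussBinom_mul (exp_nonneg (2 * a ^ 2 * u)) hq
    (F := fun j : ℤ ↦ exp (-b ^ 2 * u) * ((-1 : ℝ) ^ j * exp ((a * j + b) ^ 2 * u)))
    ((summable_altTheta ha b hu).of_norm.mul_left _)
  rw [tsum_mul_left, tsum_mul_left] at h
  refine h.congr fun N ↦ ?_
  have := prod_one_sub_exp_eq_sum (2 * a ^ 2 * u) ((a ^ 2 + 2 * a * b) * u) N
  refine Eq.trans (sum_congr rfl fun k _ ↦ ?_) (this.symm.trans (prod_congr rfl fun i _ ↦ ?_))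
  · rw [mul_left_comm (exp _), ← Real.exp_add]
    congr 3
    ring
  · congr 3 <;> ring

lemma altTheta_six_one {T : ℝ} (hT : T < 0) :
    altTheta 6 1 (T / 24) = exp (T / 24) * eulerF (exp T) := by
  have h := tendsto_prod_altTheta (a := 6) (by norm_num) 1 (u := T / 24) (by linarith)
  have hq : exp T < 1 := Real.exp_lt_one_iff.2 hT
  have hq3 : exp (2 * (6 : ℤ) ^ 2 * (T / 24)) < 1 := Real.exp_lt_one_iff.2 (by push_cast; linarith)
  have hprod (N : ℕ) : (∏ i ∈ range N, ((1 - exp ((2 * (6 : ℤ) ^ 2 * i +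
      ((6 : ℤ) ^ 2 + 2 * (6 : ℤ) * (1 : ℤ))) * (T / 24))) *
      (1 - exp ((2 * (6 : ℤ) ^ 2 * i + ((6 : ℤ) ^ 2 - 2 * (6 : ℤ) * (1 : ℤ))) * (T / 24))))) *
      eulerPartial (exp (2 * (6 : ℤ) ^ 2 * (T / 24))) N = eulerPartial (exp T) (3 * N) := by
    induction N with
    | zero => simp [eulerPartial]
    | succ N ih =>
      rw [prod_range_succ, eulerPartial_succ, mul_mul_mul_comm, ih,
        show 3 * (N + 1) = 3 * N + 1 + 1 + 1 by ring,
        eulerPartial_succ, eulerPartial_succ, eulerPartial_succ]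
      simp only [mul_assoc]
      congr 1
      simp only [← Real.exp_nat_mul]
      push_cast
      ring_nf
  have a1 : Tendsto (fun N : ℕ ↦ 3 * N) atTop atTop :=
    tendsto_atTop_mono (fun N ↦ by simp only [id]; lia) tendsto_id
  have h2 := (h.mul (tendsto_eulerPartial (exp_nonneg _) hq3)).congr hprod
  have h3 := tendsto_nhds_unique h2 ((tendsto_eulerPartial (exp_nonneg T) hq).comp a1)
  have hpos := eulerF_pos_s17 (exp_nonneg _) hq3
  rw [← h3, mul_right_comm, inv_mul_cancel₀ hpos.ne', one_mul, ← mul_assoc, ← Real.exp_add]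
  simp

lemma tendsto_prod_altTheta_ten (b : ℤ) {T : ℝ} (hT : T < 0) :
    Tendsto (fun N : ℕ ↦ ∏ i ∈ range N, ((1 - exp ((5 * i + (10 + 2 * b) / 4) * T)) *
      (1 - exp ((5 * i + (10 - 2 * b) / 4) * T)))) atTop
      (𝓝 ((eulerF (exp (5 * T)))⁻¹ * (exp (-b ^ 2 * (T / 40)) * altTheta 10 b (T / 40)))) := by
  have h := tendsto_prod_altTheta (a := 10) (by norm_num) b (u := T / 40) (by linarith)
  have e : 2 * ((10 : ℤ) : ℝ) ^ 2 * (T / 40) = 5 * T := by push_cast; ring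
  rw [e] at h
  refine h.congr fun N ↦ prod_congr rfl fun i _ ↦ ?_
  congr 3 <;> push_cast <;> ring

lemma altTheta_ten_mul {T : ℝ} (hT : T < 0) :
    altTheta 10 1 (T / 40) * altTheta 10 3 (T / 40) =
      altTheta 6 1 (T / 24) * altTheta 6 1 (5 * T / 24) := by
  have hq : exp T < 1 := Real.exp_lt_one_iff.2 hT
  have hq5 : exp (5 * T) < 1 := Real.exp_lt_one_iff.2 (by linarith)
  have h := ((tendsto_prod_altTheta_ten 1 hT).mul (tendsto_prod_altTheta_ten 3 hT)).mul
    (tendsto_eulerPartial (exp_nonneg (5 * T)) hq5)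
  have hprod (N : ℕ) : ((∏ i ∈ range N, ((1 - exp ((5 * i + (10 + 2 * (1 : ℤ)) / 4) * T)) *
      (1 - exp ((5 * i + (10 - 2 * (1 : ℤ)) / 4) * T)))) *
      ∏ i ∈ range N, ((1 - exp ((5 * i + (10 + 2 * (3 : ℤ)) / 4) * T)) *
      (1 - exp ((5 * i + (10 - 2 * (3 : ℤ)) / 4) * T)))) * eulerPartial (exp (5 * T)) N =
      eulerPartial (exp T) (5 * N) := by
    induction N with
    | zero => simp [eulerPartial]
    | succ N ih =>
      have comm (P x Q y E z : ℝ) : (P * x) * (Q * y) * (E * z) = (P * Q * E) * (x * y * z) := by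
        ring
      rw [prod_range_succ, prod_range_succ, eulerPartial_succ, comm,
        ih, show 5 * (N + 1) = 5 * N + 1 + 1 + 1 + 1 + 1 by ring, eulerPartial_succ,
        eulerPartial_succ, eulerPartial_succ, eulerPartial_succ, eulerPartial_succ]
      simp only [mul_assoc]
      congr 1
      simp only [← Real.exp_nat_mul]
      push_cast
      ring_nf
  have a1 : Tendsto (fun N : ℕ ↦ 5 * N) atTop atTop :=
    tendsto_atTop_mono (fun N ↦ by simp only [id]; lia) tendsto_id
  have h3 := tendsto_nhds_unique (h.congr hprod)
    ((tendsto_eulerPartial (exp_nonneg T) hq).comp a1)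
  have hpos := eulerF_pos_s17 (exp_nonneg _) hq5
  rw [altTheta_six_one hT, altTheta_six_one (by linarith : 5 * T < 0), ← h3]
  have e : exp (T / 24) * exp (5 * T / 24) * exp (-(1 : ℤ) ^ 2 * (T / 40)) *
      exp (-(3 : ℤ) ^ 2 * (T / 40)) = 1 := by
    rw [← Real.exp_add, ← Real.exp_add, ← Real.exp_add, Real.exp_eq_one_iff]
    push_cast; ring
  have e' : (eulerF (exp (5 * T)))⁻¹ * eulerF (exp (5 * T)) = 1 := inv_mul_cancel₀ hpos.ne'
  generalize eulerF (exp (5 * T)) = E at e' ⊢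
  generalize E⁻¹ = E' at e' ⊢
  linear_combination -altTheta 10 1 (T / 40) * altTheta 10 3 (T / 40) * (e + exp (T / 24) *
    exp (5 * T / 24) * exp (-(1 : ℤ) ^ 2 * (T / 40)) * exp (-(3 : ℤ) ^ 2 * (T / 40)) *
    (E' * E + 1) * e')

lemma altTheta_six_one_pos {u : ℝ} (hu : u < 0) : 0 < altTheta 6 1 u := by
  have h := altTheta_six_one (T := 24 * u) (by linarith)
  rw [mul_div_cancel_left₀ _ (by norm_num)] at h
  rw [h]
  exact mul_pos (exp_pos _) (eulerF_pos_s17 (exp_nonneg _) (Real.exp_lt_one_iff.2 (by linarith)))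

lemma altTheta_ten_nonneg {b : ℤ} (hb : |b| ≤ 5) {u : ℝ} (hu : u < 0) : 0 ≤ altTheta 10 b u := by
  have h := tendsto_prod_altTheta_ten b (T := 40 * u) (by linarith)
  rw [mul_div_cancel_left₀ _ (by norm_num)] at h
  obtain ⟨hb1, hb2⟩ := abs_le.1 hb
  have hb1' : (-5 : ℝ) ≤ b := by exact_mod_cast hb1
  have hb2' : (b : ℝ) ≤ 5 := by exact_mod_cast hb2
  have h0 : 0 ≤ (eulerF (exp (5 * (40 * u))))⁻¹ * (exp (-b ^ 2 * u) * altTheta 10 b u) := by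
    refine ge_of_tendsto' h fun N ↦ prod_nonneg fun i _ ↦ mul_nonneg ?_ ?_ <;>
    · rw [sub_nonneg, Real.exp_le_one_iff]
      exact mul_nonpos_of_nonneg_of_nonpos (by linarith [(i.cast_nonneg : (0 : ℝ) ≤ i)])
        (by linarith)
  have hpos := eulerF_pos_s17 (exp_nonneg (5 * (40 * u))) (Real.exp_lt_one_iff.2 (by linarith))
  rw [mul_nonneg_iff_of_pos_left (inv_pos.2 hpos), mul_nonneg_iff_of_pos_left (exp_pos _)] at h0
  exact h0

lemma altTheta_ten_pos {u : ℝ} (hu : u < 0) : 0 < altTheta 10 1 u ∧ 0 < altTheta 10 3 u := by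
  have h := altTheta_ten_mul (T := 40 * u) (by linarith)
  rw [mul_div_cancel_left₀ _ (by norm_num)] at h
  have hpos := mul_pos (altTheta_six_one_pos (u := 40 * u / 24) (by linarith))
    (altTheta_six_one_pos (u := 5 * (40 * u) / 24) (by linarith))
  rw [← h] at hpos
  exact ⟨pos_of_mul_pos_left hpos (altTheta_ten_nonneg (by norm_num) hu),
    pos_of_mul_pos_right hpos (altTheta_ten_nonneg (by norm_num) hu)⟩

/-- **Jacobi's identity** for the cube of Euler's product. -/
lemma tsum_odd_mul_exp {T : ℝ} (hT : T < 0) :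
    ∑' j : ℤ, (-1 : ℝ) ^ j * (2 * j + 1) * exp ((2 * j + 1) ^ 2 * (T / 8)) =
      2 * altTheta 6 1 (T / 24) ^ 3 := by
  have hq : exp T < 1 := Real.exp_lt_one_iff.2 hT
  have hq0 := exp_nonneg T
  have hfin (n : ℕ) : -(eulerPartial (exp T) n * eulerPartial (exp T) (n + 1)) =
      ∑ k ∈ range (2 * (n + 1) + 1), gaussBinom (exp T) (2 * (n + 1)) k *
        (fun j : ℤ ↦ (-1 : ℝ) ^ j * (j * exp (T * (j * (j - 1) / 2)))) (k - (n + 1 : ℕ)) := by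
    have hL : HasDerivAt (fun s : ℝ ↦ ∏ i ∈ range (n + 1),
        ((1 - exp (s + i * T)) * (1 - exp ((i + 1) * T - s))))
        (-(eulerPartial (exp T) n * eulerPartial (exp T) (n + 1))) 0 := by
      let R : ℝ → ℝ := fun s ↦ (∏ i ∈ range n, (1 - exp (s + (i + 1 : ℕ) * T))) *
        ∏ i ∈ range (n + 1), (1 - exp ((i + 1) * T - s))
      have hR : DifferentiableAt ℝ R 0 := by
        refine DifferentiableAt.mul ?_ ?_ <;>
        exact DifferentiableAt.fun_finsetProd fun i _ ↦ by fun_prop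
      have h1 : HasDerivAt (fun s : ℝ ↦ 1 - exp s) (-1) 0 := by
        simpa using (Real.hasDerivAt_exp 0).const_sub 1
      have h2 := h1.mul hR.hasDerivAt
      have hR0 : R 0 = eulerPartial (exp T) n * eulerPartial (exp T) (n + 1) := by
        simp only [R, eulerPartial, ← Real.exp_nat_mul]
        congr 1
        · exact prod_congr rfl fun i _ ↦ by congr 2; ring
        · exact prod_congr rfl fun i _ ↦ by congr 2; push_cast; ring
      refine (h2.congr_deriv ?_).congr_of_eventuallyEq (Eventually.of_forall fun s ↦ ?_)
      · rw [hR0]; simp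
      · simp only [R, Pi.mul_apply, prod_mul_distrib]
        rw [prod_range_succ' (fun i : ℕ ↦ 1 - exp (s + i * T))]
        simp only [Nat.cast_zero, zero_mul, add_zero]
        ring
    have hS : HasDerivAt (fun s : ℝ ↦ ∏ i ∈ range (n + 1),
        ((1 - exp (s + i * T)) * (1 - exp ((i + 1) * T - s))))
        (∑ k ∈ range (2 * (n + 1) + 1), gaussBinom (exp T) (2 * (n + 1)) k *
        (fun j : ℤ ↦ (-1 : ℝ) ^ j * (j * exp (T * (j * (j - 1) / 2)))) (k - (n + 1 : ℕ))) 0 := by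
      simp_rw [prod_one_sub_exp_eq_sum]
      refine HasDerivAt.fun_sum fun k _ ↦ ?_
      refine HasDerivAt.const_mul _ (HasDerivAt.const_mul _ ?_)
      generalize (k : ℤ) - ((n + 1 : ℕ) : ℤ) = j
      have := (((hasDerivAt_id (0 : ℝ)).mul_const (j : ℝ)).const_add
        (T * (j * (j - 1) / 2))).exp
      refine this.congr_deriv ?_
      simp
      ring
    exact hL.unique hS
  have hsq (j : ℤ) : exp (T * (j * (j - 1) / 2)) =
      exp (-T / 8) * exp (((2 : ℤ) * j + (-1 : ℤ)) ^ 2 * (T / 8)) := by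
    rw [← Real.exp_add]; congr 1; push_cast; ring
  have s0 := summable_pow_mul_exp_sq (a := 2) (by norm_num) (-1) (t := T / 8) (by linarith) 0
  have s1 := summable_pow_mul_exp_sq (a := 2) (by norm_num) (-1) (t := T / 8) (by linarith) 1
  have hsum : Summable fun j : ℤ ↦ (-1 : ℝ) ^ j * (j * exp (T * (j * (j - 1) / 2))) := by
    refine Summable.of_norm_bounded (((s0.add s1).mul_left (exp (-T / 8))).mul_left (1 / 2))
      fun j ↦ ?_
    rw [norm_mul, norm_zpow, norm_neg, norm_one, one_zpow, one_mul, norm_mul, hsq, Real.norm_eq_abs,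
      Real.norm_eq_abs, abs_of_pos (by positivity : 0 < exp (-T / 8) * _)]
    have : |(j : ℝ)| ≤ 1 / 2 * (1 + |((2 : ℤ) : ℝ) * j + (-1 : ℤ)|) := by
      push_cast
      have h1 := abs_le.1 (le_refl |2 * (j : ℝ) + -1|)
      exact abs_le.2 ⟨by linarith [h1.1], by linarith [h1.2]⟩
    have h0 : 0 < exp (-T / 8) * exp (((2 : ℤ) * j + (-1 : ℤ)) ^ 2 * (T / 8)) := by positivity
    nlinarith [mul_le_mul_of_nonneg_right this h0.le]
  have hlim := (tendsto_sum_gaussBinom_mul hq0 hq hsum).comp (tendsto_add_atTop_nat 1)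
  have ht := tendsto_eulerPartial hq0 hq
  have hlim2 := (ht.mul (ht.comp (tendsto_add_atTop_nat 1))).neg
  have key := tendsto_nhds_unique hlim (hlim2.congr hfin)
  have hpos := eulerF_pos_s17 hq0 hq
  rw [tsum_mul_left, inv_mul_eq_iff_eq_mul₀ hpos.ne'] at key
  set K := ∑' j : ℤ, (-1 : ℝ) ^ j * (j * exp (T * (j * (j - 1) / 2))) with hK
  have hK2 : K = ∑' j : ℤ, (-1 : ℝ) ^ j * ((j - 1) * exp (T * (j * (j - 1) / 2))) := by
    rw [hK, ← (Equiv.subLeft (1 : ℤ)).tsum_eq]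
    refine tsum_congr fun j ↦ ?_
    simp only [Equiv.subLeft_apply]
    rw [zpow_sub₀ (by norm_num), zpow_one, neg_div, one_div, ← inv_zpow, inv_neg_one]
    have e : T * (((1 - j : ℤ) : ℝ) * (((1 - j : ℤ) : ℝ) - 1) / 2) = T * (j * (j - 1) / 2) := by
      push_cast; ring
    rw [e]; push_cast; ring
  have hsum2 : Summable fun j : ℤ ↦ (-1 : ℝ) ^ j * ((j - 1) * exp (T * (j * (j - 1) / 2))) := by
    have := s0.mul_left (exp (-T / 8))
    refine (hsum.sub (Summable.of_norm (f := fun j : ℤ ↦ (-1 : ℝ) ^ j *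
      exp (T * (j * (j - 1) / 2))) (this.congr fun j ↦ ?_))).congr fun j ↦ by ring
    rw [norm_mul, norm_zpow, norm_neg, norm_one, one_zpow, one_mul, hsq, Real.norm_eq_abs,
      pow_zero, one_mul, abs_of_pos (mul_pos (exp_pos _) (exp_pos _))]
  have h2K : 2 * K = ∑' j : ℤ, (-1 : ℝ) ^ j * ((2 * j - 1) * exp (T * (j * (j - 1) / 2))) := by
    rw [two_mul]
    nth_rw 2 [hK2]
    rw [hK, ← hsum.tsum_add hsum2]
    exact tsum_congr fun j ↦ by ring
  rw [altTheta_six_one hT]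
  have hJ : ∑' j : ℤ, (-1 : ℝ) ^ j * (2 * j + 1) * exp ((2 * j + 1) ^ 2 * (T / 8)) =
      -exp (T / 8) * (2 * K) := by
    rw [h2K, ← tsum_mul_left, ← (Equiv.addRight (1 : ℤ)).tsum_eq
      (fun j : ℤ ↦ -exp (T / 8) * ((-1 : ℝ) ^ j * ((2 * j - 1) * exp (T * (j * (j - 1) / 2)))))]
    refine tsum_congr fun j ↦ ?_
    simp only [Equiv.coe_addRight]
    have e : exp ((2 * j + 1) ^ 2 * (T / 8)) =
        exp (T / 8) * exp (T * (((j + 1 : ℤ) : ℝ) * (((j + 1 : ℤ) : ℝ) - 1) / 2)) := by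
      rw [← Real.exp_add]; congr 1; push_cast; ring
    rw [e, zpow_add_one₀ (by norm_num)]
    push_cast; ring
  have e3 : exp (T / 8) = exp (T / 24) ^ 3 := by
    rw [← Real.exp_nat_mul]; congr 1; push_cast; ring
  rw [hJ, key, e3]
  ring

lemma neg_one_zpow_congr {a b : ℤ} (h : (a - b) % 2 = 0) : (-1 : ℝ) ^ a = (-1) ^ b := by
  have : a = b + (a - b) := by ring
  rw [this, zpow_add₀ (by norm_num), (Int.even_iff.2 h).neg_one_zpow, mul_one]

lemma neg_one_zpow_congr_neg {a b : ℤ} (h : (a - b) % 2 = 1) : (-1 : ℝ) ^ a = -(-1) ^ b := by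
  have : a = b + (a - b) := by ring
  rw [this, zpow_add₀ (by norm_num), (Int.odd_iff.2 h).neg_one_zpow, mul_neg_one]

lemma tsum_eq_tsum_add_tsum {α β : Type*} {φ ψ : α → β} (h : Function.Bijective (Sum.elim φ ψ))
    {G : β → ℝ} (hG : Summable G) : ∑' b, G b = ∑' a, G (φ a) + ∑' a, G (ψ a) := by
  have h1 : Summable (G ∘ φ) := hG.comp_injective (h.1.comp Sum.inl_injective)
  have h2 : Summable (G ∘ ψ) := hG.comp_injective (h.1.comp Sum.inr_injective)
  have h3 : HasSum (G ∘ Sum.elim φ ψ) _ := HasSum.sum h1.hasSum h2.hasSum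
  exact ((Equiv.ofBijective _ h).hasSum_iff.1 h3).tsum_eq

lemma summable_mul_altTheta {a c : ℤ} (ha : a ≠ 0) (hc : c ≠ 0) (b d : ℤ) {s t : ℝ} (hs : s < 0)
    (ht : t < 0) : Summable fun p : ℤ × ℤ ↦
      (-1 : ℝ) ^ (p.1 + p.2) * exp ((a * p.1 + b) ^ 2 * s + (c * p.2 + d) ^ 2 * t) := by
  refine (summable_mul_of_summable_norm (summable_altTheta ha b hs)
    (summable_altTheta hc d ht)).congr fun p ↦ ?_
  rw [zpow_add₀ (by norm_num), Real.exp_add, mul_mul_mul_comm]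

lemma altTheta_mul_altTheta {a c : ℤ} (ha : a ≠ 0) (hc : c ≠ 0) (b d : ℤ) {s t : ℝ} (hs : s < 0)
    (ht : t < 0) : altTheta a b s * altTheta c d t = ∑' p : ℤ × ℤ,
      (-1 : ℝ) ^ (p.1 + p.2) * exp ((a * p.1 + b) ^ 2 * s + (c * p.2 + d) ^ 2 * t) := by
  rw [altTheta, altTheta, tsum_mul_tsum_of_summable_norm (summable_altTheta ha b hs)
    (summable_altTheta hc d ht)]
  refine tsum_congr fun p ↦ ?_
  rw [zpow_add₀ (by norm_num), Real.exp_add, mul_mul_mul_comm]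

/-- The even and odd cosets of an index-two shear of `ℤ²`. -/
lemma bijective_shear_two :
    Function.Bijective (Sum.elim (fun p : ℤ × ℤ ↦ (p.1, 2 * p.2 - p.1))
      fun p : ℤ × ℤ ↦ (p.1, 2 * p.2 + 1 - p.1)) := by
  constructor
  · rintro (⟨x, y⟩ | ⟨x, y⟩) (⟨z, w⟩ | ⟨z, w⟩) h <;> simp at h ⊢ <;> omega
  · rintro ⟨x, y⟩
    rcases Int.emod_two_eq_zero_or_one (x + y) with h | h
    · exact ⟨.inl (x, (x + y) / 2), by simp; omega⟩
    · exact ⟨.inr (x, (x + y) / 2), by simp; omega⟩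

lemma altTheta_thirty_add_mul {τ : ℝ} (hτ : τ < 0) :
    (altTheta 30 1 τ + altTheta 30 11 τ) * altTheta 10 3 (3 * τ) =
      altTheta 6 1 (25 * τ) * altTheta 10 1 (3 * τ) := by
  have h3 : 3 * τ < 0 := by linarith
  have h25 : 25 * τ < 0 := by linarith
  have h30 : (30 : ℤ) ≠ 0 := by norm_num
  have h10 : (10 : ℤ) ≠ 0 := by norm_num
  have h6 : (6 : ℤ) ≠ 0 := by norm_num
  have bF' : Function.Bijective (Sum.elim (fun p : ℤ × ℤ ↦ (p.1 - p.2 - 1, -p.1 - p.2 - 1))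
      fun p : ℤ × ℤ ↦ (p.1, 2 * p.2 + 1 - p.1)) := by
    constructor
    · rintro (⟨x, y⟩ | ⟨x, y⟩) (⟨z, w⟩ | ⟨z, w⟩) h <;> simp at h ⊢ <;> omega
    · rintro ⟨x, y⟩
      rcases Int.emod_two_eq_zero_or_one (x + y) with h | h
      · exact ⟨.inl ((x - y) / 2, -(x + y) / 2 - 1), by simp; omega⟩
      · exact ⟨.inr (x, (x + y) / 2), by simp; omega⟩
  have bG : Function.Bijective (Sum.elim (fun p : ℤ × ℤ ↦ (p.2, p.2 - 2 * p.1))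
      fun p : ℤ × ℤ ↦ (-p.2 - 1, p.2 - 2 * p.1)) := by
    constructor
    · rintro (⟨x, y⟩ | ⟨x, y⟩) (⟨z, w⟩ | ⟨z, w⟩) h <;> simp at h ⊢ <;> omega
    · rintro ⟨x, y⟩
      rcases Int.emod_two_eq_zero_or_one (x + y) with h | h
      · exact ⟨.inl ((x - y) / 2, x), by simp; omega⟩
      · exact ⟨.inr ((-x - 1 - y) / 2, -x - 1), by simp; omega⟩
  rw [add_mul]
  simp only [altTheta_mul_altTheta h30 h10
      _ _ hτ h3,
    altTheta_mul_altTheta h6 h10 _ _ h25 h3]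
  rw [tsum_eq_tsum_add_tsum bijective_shear_two (summable_mul_altTheta h30 h10 _ _ hτ h3),
    tsum_eq_tsum_add_tsum bF' (summable_mul_altTheta h30 h10 _ _ hτ h3),
    tsum_eq_tsum_add_tsum bG (summable_mul_altTheta h6 h10 _ _ h25 h3)]
  have e {A B C D E F : ℝ} (h1 : A = E) (h2 : B = -C) (h3 : D = F) : A + B + (C + D) = E + F := by
    rw [h1, h2, h3]; ring
  refine e (tsum_congr fun p ↦ ?_) ?_ (tsum_congr fun p ↦ ?_)
  · congr 1
    · exact neg_one_zpow_congr (by omega)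
    · congr 1; push_cast; ring
  · rw [← tsum_neg]
    refine tsum_congr fun p ↦ ?_
    rw [← neg_mul]
    congr 1
    · exact neg_one_zpow_congr_neg (by omega)
    · congr 1; push_cast; ring
  · congr 1
    · exact neg_one_zpow_congr (by omega)
    · congr 1; push_cast; ring

lemma altTheta_thirty_sub_mul {τ : ℝ} (hτ : τ < 0) :
    (altTheta 30 7 τ - altTheta 30 13 τ) * altTheta 10 1 (3 * τ) =
      altTheta 6 1 (25 * τ) * altTheta 10 3 (3 * τ) := by
  have h3 : 3 * τ < 0 := by linarith
  have h25 : 25 * τ < 0 := by linarith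
  have h30 : (30 : ℤ) ≠ 0 := by norm_num
  have h10 : (10 : ℤ) ≠ 0 := by norm_num
  have h6 : (6 : ℤ) ≠ 0 := by norm_num
  have bF' : Function.Bijective (Sum.elim (fun p : ℤ × ℤ ↦ (p.1, 2 * p.2 - p.1))
      fun p : ℤ × ℤ ↦ (p.2 - p.1, -p.1 - p.2 - 1)) := by
    constructor
    · rintro (⟨x, y⟩ | ⟨x, y⟩) (⟨z, w⟩ | ⟨z, w⟩) h <;> simp at h ⊢ <;> omega
    · rintro ⟨x, y⟩
      rcases Int.emod_two_eq_zero_or_one (x + y) with h | h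
      · exact ⟨.inl (x, (x + y) / 2), by simp; omega⟩
      · exact ⟨.inr ((-x - y - 1) / 2, (x - y - 1) / 2), by simp; omega⟩
  have bG : Function.Bijective (Sum.elim (fun p : ℤ × ℤ ↦ (p.2, 2 * p.1 - p.2))
      fun p : ℤ × ℤ ↦ (p.1 - p.2, -p.1 - p.2 - 1)) := by
    constructor
    · rintro (⟨x, y⟩ | ⟨x, y⟩) (⟨z, w⟩ | ⟨z, w⟩) h <;> simp at h ⊢ <;> omega
    · rintro ⟨x, y⟩
      rcases Int.emod_two_eq_zero_or_one (x + y) with h | h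
      · exact ⟨.inl ((x + y) / 2, x), by simp; omega⟩
      · exact ⟨.inr ((x - y - 1) / 2, (-x - y - 1) / 2), by simp; omega⟩
  rw [sub_mul]
  simp only [altTheta_mul_altTheta h30 h10
      _ _ hτ h3,
    altTheta_mul_altTheta h6 h10 _ _ h25 h3]
  rw [tsum_eq_tsum_add_tsum bijective_shear_two (summable_mul_altTheta h30 h10 _ _ hτ h3),
    tsum_eq_tsum_add_tsum bF' (summable_mul_altTheta h30 h10 _ _ hτ h3),
    tsum_eq_tsum_add_tsum bG (summable_mul_altTheta h6 h10 _ _ h25 h3)]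
  have e {A B C D E F : ℝ} (h1 : A = E) (h2 : B = D) (h3 : F = -C) : A + B - (C + D) = E + F := by
    rw [h1, h2, h3]; ring
  refine e (tsum_congr fun p ↦ ?_) (tsum_congr fun p ↦ ?_) ?_
  · congr 1
    · exact neg_one_zpow_congr (by omega)
    · congr 1; push_cast; ring
  · congr 1
    · exact neg_one_zpow_congr (by omega)
    · congr 1; push_cast; ring
  · rw [← tsum_neg]
    refine tsum_congr fun p ↦ ?_
    rw [← neg_mul]
    congr 1
    · exact neg_one_zpow_congr_neg (by omega)
    · congr 1; push_cast; ring

lemma altTheta_neg (a b : ℤ) (t : ℝ) : altTheta a (-b) t = altTheta a b t := by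
  rw [altTheta, altTheta, ← (Equiv.neg ℤ).tsum_eq]
  refine tsum_congr fun n ↦ ?_
  simp only [Equiv.neg_apply]
  congr 1
  · exact neg_one_zpow_congr (by omega)
  · congr 1; push_cast; ring

lemma altTheta_add (a b : ℤ) (t : ℝ) : altTheta a (b + a) t = -altTheta a b t := by
  rw [altTheta, altTheta,
    ← (Equiv.addRight (1 : ℤ)).tsum_eq (fun n : ℤ ↦ _ * exp ((a * n + b) ^ 2 * t)), ← tsum_neg]
  refine tsum_congr fun n ↦ ?_
  simp only [Equiv.coe_addRight]
  rw [← neg_mul]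
  congr 1
  · exact neg_one_zpow_congr_neg (by omega)
  · congr 1; push_cast; ring

/-- The 5-dissection of the eta series. -/
lemma altTheta_six_one_dissection {τ : ℝ} (hτ : τ < 0) :
    altTheta 6 1 τ = altTheta 30 1 τ + altTheta 30 11 τ - altTheta 30 7 τ + altTheta 30 13 τ -
      altTheta 6 1 (25 * τ) := by
  have h25 : altTheta 6 1 (25 * τ) = -altTheta 30 25 τ := by
    rw [show (25 : ℤ) = -5 + 30 by norm_num, altTheta_add, altTheta_neg, neg_neg]
    refine tsum_congr fun n ↦ ?_
    congr 2; push_cast; ring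
  have h11 : altTheta 30 11 τ = -altTheta 30 19 τ := by
    rw [show (19 : ℤ) = -11 + 30 by norm_num, altTheta_add, altTheta_neg, neg_neg]
  have bij : Function.Bijective fun p : Fin 5 × ℤ ↦ 5 * p.2 + (p.1 : ℤ) := by
    constructor
    · rintro ⟨x, y⟩ ⟨z, w⟩ h
      simp only [Prod.mk.injEq, Fin.ext_iff] at h ⊢
      omega
    · intro x
      exact ⟨(⟨(x % 5).toNat, by omega⟩, x / 5), by simp; omega⟩
  have hs := (summable_altTheta (a := 6) (by norm_num) 1 hτ).of_norm
  have hs' := ((Equiv.ofBijective _ bij).summable_iff).2 hs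
  have hr (r : Fin 5) : ∑' n : ℤ, (-1 : ℝ) ^ (5 * n + (r : ℤ)) *
      exp (((6 : ℤ) * (5 * n + (r : ℤ) : ℤ) + (1 : ℤ)) ^ 2 * τ) =
      (-1) ^ (r : ℕ) * altTheta 30 (6 * (r : ℕ) + 1) τ := by
    rw [altTheta, ← tsum_mul_left]
    refine tsum_congr fun n ↦ ?_
    rw [zpow_add₀ (by norm_num), zpow_natCast, neg_one_zpow_congr (a := 5 * n) (b := n) (by omega),
      mul_comm (_ ^ n), mul_assoc]
    congr 3
    push_cast
    ring
  rw [altTheta, ← (Equiv.ofBijective _ bij).tsum_eq, h25, h11]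
  refine hs'.tsum_prod.trans ((tsum_fintype _).trans ((sum_congr rfl fun r _ ↦ hr r).trans ?_))
  rw [Fin.sum_univ_five]
  norm_num
  ring

/-- The modular equation expressing `y` through the quotient of two theta series. -/
lemma yF_exp {T : ℝ} (hT : T < 0) :
    yF (exp T) = altTheta 10 1 (T / 40) / altTheta 10 3 (T / 40) - 1 -
      altTheta 10 3 (T / 40) / altTheta 10 1 (T / 40) := by
  obtain ⟨hα, hβ⟩ := altTheta_ten_pos (u := T / 40) (by linarith)
  have hη := altTheta_six_one_pos (u := 5 * T / 24) (by linarith)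
  have hτ : T / 120 < 0 := by linarith
  have d := altTheta_six_one_dissection hτ
  have h1 := altTheta_thirty_add_mul hτ
  have h2 := altTheta_thirty_sub_mul hτ
  rw [show 3 * (T / 120) = T / 40 by ring, show 25 * (T / 120) = 5 * T / 24 by ring] at *
  have hy : yF (exp T) = altTheta 6 1 (T / 120) / altTheta 6 1 (5 * T / 24) := by
    have e1 := altTheta_six_one (T := T / 5) (by linarith)
    have e2 := altTheta_six_one (T := 5 * T) (by linarith)
    rw [show T / 5 / 24 = T / 120 by ring] at e1
    rw [yF, e1, e2, ← Real.exp_mul, ← Real.exp_nat_mul, mul_one_div,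
      show 5 * T / 24 = T / 5 + T / 120 by ring, Real.exp_add,
      mul_comm (exp (T / 5)) (exp (T / 120)), mul_assoc, mul_div_mul_left _ _ (exp_pos _).ne']
    rfl
  rw [hy, d]
  generalize altTheta 6 1 (5 * T / 24) = η at *
  field_simp
  linear_combination altTheta 10 1 (T / 40) * h1 - altTheta 10 3 (T / 40) * h2

lemma hasDerivAt_altTheta {a : ℤ} (ha : a ≠ 0) (b : ℤ) {t : ℝ} (ht : t < 0) :
    HasDerivAt (altTheta a b)
      (∑' n : ℤ, (-1) ^ n * ((a * n + b) ^ 2 * exp ((a * n + b) ^ 2 * t))) t := by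
  have ht2 : t / 2 < 0 := by linarith
  have hmem : t ∈ Set.Iio (t / 2) := by simp only [Set.mem_Iio]; linarith
  refine hasDerivAt_tsum_of_isPreconnected (t := Set.Iio (t / 2)) (y₀ := t)
    (g := fun (n : ℤ) (s : ℝ) ↦ (-1 : ℝ) ^ n * exp ((a * n + b) ^ 2 * s))
    (g' := fun (n : ℤ) (s : ℝ) ↦ (-1 : ℝ) ^ n * ((a * n + b) ^ 2 * exp ((a * n + b) ^ 2 * s)))
    (u := fun n : ℤ ↦ (|a * n + b| : ℝ) ^ 2 * exp ((a * n + b) ^ 2 * (t / 2)))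
    (summable_pow_mul_exp_sq ha b ht2 2) isOpen_Iio (convex_Iio _).isPreconnected
    (fun n y _ ↦ ?_) (fun n y hy ↦ ?_) hmem (summable_altTheta ha b ht).of_norm hmem
  · have := ((hasDerivAt_id y).const_mul (((a : ℝ) * n + b) ^ 2)).exp.const_mul ((-1 : ℝ) ^ n)
    refine this.congr_deriv ?_
    simp only [id]
    ring
  · simp only [norm_mul, norm_zpow, norm_neg, norm_one, one_zpow, one_mul, norm_pow,
      Real.norm_eq_abs, Real.abs_exp]
    have : y ≤ t / 2 := le_of_lt hy
    gcongr

lemma summable_sq_mul_altTheta {a : ℤ} (ha : a ≠ 0) (b : ℤ) {t : ℝ} (ht : t < 0) :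
    Summable fun n : ℤ ↦ ‖(-1 : ℝ) ^ n * ((a * n + b) ^ 2 * exp ((a * n + b) ^ 2 * t))‖ := by
  refine (summable_pow_mul_exp_sq ha b ht 2).congr fun n ↦ ?_
  simp

/-- A shear of `ℤ²` of index five, together with its cosets. -/
lemma bijective_shear_five : Function.Bijective
    fun p : Fin 5 × ℤ × ℤ ↦ (2 * p.2.1 + p.2.2 + (p.1 : ℤ), 2 * p.2.2 - p.2.1) := by
  constructor
  · rintro ⟨x, y, z⟩ ⟨x', y', z'⟩ h
    simp only [Prod.mk.injEq, Fin.ext_iff] at h ⊢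
    omega
  · rintro ⟨i, j⟩
    refine ⟨(⟨((i + 2 * j) % 5).toNat, by omega⟩, (2 * ((i + 2 * j) / 5) - j), (i + 2 * j) / 5), ?_⟩
    simp
    omega

lemma wronskian_altTheta {T : ℝ} (hT : T < 0) :
    altTheta 10 1 (T / 40) * deriv (altTheta 10 3) (T / 40) -
      deriv (altTheta 10 1) (T / 40) * altTheta 10 3 (T / 40) =
      8 * altTheta 6 1 (T / 24) ^ 6 := by
  have hu : T / 40 < 0 := by linarith
  have hv : T / 8 < 0 := by linarith
  have key {s s' : ℤ} {c c' e e' : ℝ} (hs : (s - s') % 2 = 0) (hc : c = c') (he : e = e') :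
      (-1) ^ s * (c * exp e) = (-1) ^ s' * (c' * exp e') := by
    rw [neg_one_zpow_congr hs, hc, he]
  let G : ℤ × ℤ → ℝ := fun p ↦ (-1) ^ (p.1 + p.2) *
    ((3 * (2 * p.2 + 1) ^ 2 - 3 * (2 * p.1 + 1) ^ 2 + 8 * ((2 * p.1 + 1) * (2 * p.2 + 1))) *
    exp (((2 * p.1 + 1) ^ 2 + (2 * p.2 + 1) ^ 2) * (T / 8)))
  have hH : HasSum G (8 * (2 * altTheta 6 1 (T / 24) ^ 3) ^ 2) := by
    have s0 := summable_altTheta (a := 2) (by norm_num) 1 hv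
    have s2 := summable_sq_mul_altTheta (a := 2) (by norm_num) 1 hv
    have s1 : Summable fun j : ℤ ↦ ‖(-1 : ℝ) ^ j * (2 * j + 1) * exp ((2 * j + 1) ^ 2 * (T / 8))‖ :=
      (summable_pow_mul_exp_sq (a := 2) (by norm_num) 1 hv 1).congr fun n ↦ by simp
    have h1 := (summable_mul_of_summable_norm s1 s1).hasSum
    rw [← tsum_mul_tsum_of_summable_norm s1 s1, tsum_odd_mul_exp hT] at h1
    have h2 := (summable_mul_of_summable_norm s0 s2).hasSum
    have h3 := (Equiv.prodComm ℤ ℤ).hasSum_iff.2 h2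
    have := ((h2.mul_left 3).sub (h3.mul_left 3)).add (h1.mul_left 8)
    rw [sub_self, zero_add, ← sq] at this
    refine this.congr_fun fun p ↦ ?_
    simp only [G, Function.comp, Equiv.prodComm_apply, Prod.fst_swap, Prod.snd_swap]
    rw [zpow_add₀ (by norm_num), add_mul _ _ (T / 8), Real.exp_add]
    push_cast
    ring
  let S : ℤ → ℝ := fun r ↦ ∑' p : ℤ × ℤ, G (2 * p.1 + p.2 + r, 2 * p.2 - p.1)
  have hS : 8 * (2 * altTheta 6 1 (T / 24) ^ 3) ^ 2 = S 0 + S 1 + S 2 + S 3 + S 4 := by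
    have hs := ((Equiv.ofBijective _ bijective_shear_five).hasSum_iff).2 hH
    rw [← hs.tsum_eq]
    refine hs.summable.tsum_prod.trans ((tsum_fintype _).trans ?_)
    rw [Fin.sum_univ_five]
    rfl
  have hS1 : S 1 = 0 := by
    have : S 1 = -S 1 := by
      simp only [S]
      nth_rw 1 [← (Equiv.prodComm ℤ ℤ).tsum_eq]
      rw [← tsum_neg]
      refine tsum_congr fun p ↦ ?_
      simp only [G, Equiv.prodComm_apply, Prod.fst_swap, Prod.snd_swap]
      rw [← mul_neg, ← neg_mul]
      refine key (by omega) ?_ ?_ <;> push_cast <;> ring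
    linarith
  have hS2 : S 2 = S 0 := by
    simp only [S]
    rw [← ((Equiv.subLeft (-1 : ℤ)).prodCongr (Equiv.subLeft (-1 : ℤ))).tsum_eq]
    refine tsum_congr fun p ↦ ?_
    simp only [G, Equiv.prodCongr_apply, Prod.map, Equiv.subLeft_apply]
    refine key (by omega) ?_ ?_ <;> push_cast <;> ring
  have hS3 : S 3 = S 4 := by
    simp only [S]
    rw [← ((Equiv.subLeft (-3 : ℤ)).prodCongr (Equiv.subLeft (-2 : ℤ))).tsum_eq]
    refine tsum_congr fun p ↦ ?_
    simp only [G, Equiv.prodCongr_apply, Prod.map, Equiv.subLeft_apply]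
    refine key (by omega) ?_ ?_ <;> push_cast <;> ring
  have hS4 : S 4 = S 0 := by
    simp only [S]
    rw [← ((Equiv.prodComm ℤ ℤ).trans
      ((Equiv.subLeft (-2 : ℤ)).prodCongr (Equiv.subRight (1 : ℤ)))).tsum_eq]
    refine tsum_congr fun p ↦ ?_
    simp only [G, Equiv.trans_apply, Equiv.prodCongr_apply, Prod.map, Equiv.subLeft_apply,
      Equiv.subRight_apply, Equiv.prodComm_apply, Prod.fst_swap, Prod.snd_swap]
    rw [neg_one_zpow_congr_neg (b := 2 * p.1 + p.2 + 0 + (2 * p.2 - p.1)) (by omega), neg_mul,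
      ← mul_neg, ← neg_mul]
    refine key (by omega) ?_ ?_ <;> push_cast <;> ring
  have n10 : (10 : ℤ) ≠ 0 := by norm_num
  have hW : S 0 = altTheta 10 1 (T / 40) * deriv (altTheta 10 3) (T / 40) -
      deriv (altTheta 10 1) (T / 40) * altTheta 10 3 (T / 40) := by
    rw [(hasDerivAt_altTheta n10 1 hu).deriv, (hasDerivAt_altTheta n10 3 hu).deriv]
    have a1 := summable_altTheta n10 1 hu
    have a3 := summable_altTheta n10 3 hu
    have b1 := summable_sq_mul_altTheta n10 1 hu
    have b3 := summable_sq_mul_altTheta n10 3 hu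
    rw [altTheta, altTheta, tsum_mul_tsum_of_summable_norm a1 b3,
      tsum_mul_tsum_of_summable_norm b1 a3,
      ← (summable_mul_of_summable_norm a1 b3).tsum_sub (summable_mul_of_summable_norm b1 a3)]
    refine tsum_congr fun p ↦ ?_
    have e : (-1 : ℝ) ^ p.1 * exp (((10 : ℤ) * p.1 + (1 : ℤ)) ^ 2 * (T / 40)) *
        ((-1) ^ p.2 * (((10 : ℤ) * p.2 + (3 : ℤ)) ^ 2 *
          exp (((10 : ℤ) * p.2 + (3 : ℤ)) ^ 2 * (T / 40)))) -
        (-1) ^ p.1 * (((10 : ℤ) * p.1 + (1 : ℤ)) ^ 2 *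
          exp (((10 : ℤ) * p.1 + (1 : ℤ)) ^ 2 * (T / 40))) *
        ((-1) ^ p.2 * exp (((10 : ℤ) * p.2 + (3 : ℤ)) ^ 2 * (T / 40))) =
        (-1 : ℝ) ^ (p.1 + p.2) * ((((10 : ℤ) * p.2 + (3 : ℤ)) ^ 2 -
          ((10 : ℤ) * p.1 + (1 : ℤ)) ^ 2) * exp (((10 : ℤ) * p.1 + (1 : ℤ)) ^ 2 * (T / 40) +
          ((10 : ℤ) * p.2 + (3 : ℤ)) ^ 2 * (T / 40))) := by
      rw [zpow_add₀ (by norm_num), Real.exp_add]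
      ring
    rw [e]
    refine key (by omega) ?_ ?_ <;> push_cast <;> ring
  rw [← hW]
  rw [hS1, hS2, hS3, hS4] at hS
  linear_combination -hS / 4

lemma yF_pos {q : ℝ} (h0 : 0 < q) (h1 : q < 1) : 0 < yF q := by
  have h5 : q ^ ((1 : ℝ) / 5) < 1 := Real.rpow_lt_one h0.le h1 (by norm_num)
  exact div_pos (eulerF_pos_s17 (by positivity) h5)
    (mul_pos (by positivity) (eulerF_pos_s17 (by positivity) (pow_lt_one₀ h0.le h1 (by norm_num))))

lemma hasDerivAt_yF {q : ℝ} (h0 : 0 < q) (h1 : q < 1) :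
    HasDerivAt yF (-(√(5 + 2 * yF q + yF q ^ 2) * eulerF q ^ 5 / (5 * q * eulerF (q ^ 5)))) q := by
  have hT : log q < 0 := Real.log_neg h0 h1
  have hu : log q / 40 < 0 := by linarith
  obtain ⟨hα, hβ⟩ := altTheta_ten_pos hu
  have e1 := altTheta_six_one hT
  have e2 := altTheta_six_one (T := 5 * log q) (by linarith)
  have hη := altTheta_six_one_pos (u := log q / 24) (by linarith)
  have hη5 := altTheta_six_one_pos (u := 5 * log q / 24) (by linarith)
  have hratio : eulerF q ^ 5 / eulerF (q ^ 5) =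
      altTheta 6 1 (log q / 24) ^ 5 / altTheta 6 1 (5 * log q / 24) := by
    have e5 : exp (5 * log q) = q ^ 5 := by
      rw [mul_comm, Real.exp_mul, Real.exp_log h0]; norm_cast
    rw [e1, e2, mul_pow, ← Real.exp_nat_mul, Real.exp_log h0, e5, mul_div_assoc (5 : ℝ),
      Nat.cast_ofNat, mul_div_mul_left _ _ (exp_pos _).ne']
  have d1 := (hasDerivAt_altTheta (a := 10) (by norm_num) 1 hu).differentiableAt.hasDerivAt
  have d3 := (hasDerivAt_altTheta (a := 10) (by norm_num) 3 hu).differentiableAt.hasDerivAt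
  have dl : HasDerivAt (fun s ↦ log s / 40) (q⁻¹ / 40) q :=
    (Real.hasDerivAt_log h0.ne').div_const 40
  have c1 := d1.comp q dl
  have c3 := d3.comp q dl
  have hd := ((c1.div c3 hβ.ne').sub_const 1).sub (c3.div c1 hα.ne')
  have hy : ∀ s ∈ Set.Ioo (0 : ℝ) 1, yF s =
      altTheta 10 1 (log s / 40) / altTheta 10 3 (log s / 40) - 1 -
      altTheta 10 3 (log s / 40) / altTheta 10 1 (log s / 40) := fun s hs ↦ by
    simpa only [Real.exp_log hs.1] using yF_exp (Real.log_neg hs.1 hs.2)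
  refine (hd.congr_of_eventuallyEq ?_).congr_deriv ?_
  · filter_upwards [Ioo_mem_nhds h0 h1] with s hs
    exact hy s hs
  have hsqrt : √(5 + 2 * yF q + yF q ^ 2) =
      altTheta 10 1 (log q / 40) / altTheta 10 3 (log q / 40) +
      altTheta 10 3 (log q / 40) / altTheta 10 1 (log q / 40) := by
    rw [Real.sqrt_eq_iff_mul_self_eq (by nlinarith [sq_nonneg (yF q + 1)]) (by positivity),
      hy q ⟨h0, h1⟩]
    field_simp
    ring
  have W := wronskian_altTheta hT
  have hM := altTheta_ten_mul hT
  rw [hsqrt, mul_div_mul_comm, hratio]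
  simp only [Function.comp]
  generalize altTheta 10 1 (log q / 40) = α at *
  generalize altTheta 10 3 (log q / 40) = β at *
  generalize altTheta 6 1 (log q / 24) = η at *
  generalize altTheta 6 1 (5 * log q / 24) = η₅ at *
  generalize deriv (altTheta 10 1) (log q / 40) = A at *
  generalize deriv (altTheta 10 3) (log q / 40) = B at *
  have hr : η ^ 5 / η₅ = η ^ 6 / (α * β) := by
    rw [hM]; field_simp
  rw [hr]
  field_simp
  linear_combination -5 * (α ^ 2 + β ^ 2) * W

end

theorem integral_yk (k : ℝ) (a b : ℝ) (ha : 0 < a) (hab : a ≤ b) (hb : b < 1) :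
    ∫ q in a..b,
        yF q ^ k * q ^ (-(4 : ℝ) / 5) * eulerF q ^ 5 / eulerF (q ^ ((1 : ℝ) / 5)) =
      -5 * ∫ x in yF a..yF b, x ^ (k - 1) / Real.sqrt (5 + 2 * x + x ^ 2) := by
  have hmem : ∀ q ∈ Set.uIcc a b, 0 < q ∧ q < 1 := fun q hq ↦ by
    rw [Set.uIcc_of_le hab] at hq
    exact ⟨ha.trans_le hq.1, hq.2.trans_lt hb⟩
  have hd : ∀ q ∈ Set.uIcc a b, HasDerivAt yF
      (-(√(5 + 2 * yF q + yF q ^ 2) * eulerF q ^ 5 / (5 * q * eulerF (q ^ 5)))) q :=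
    fun q hq ↦ hasDerivAt_yF (hmem q hq).1 (hmem q hq).2
  have hF : ∀ q : ℝ, 0 < q → q < 1 → 0 < eulerF q ∧ 0 < eulerF (q ^ 5) := fun q h0 h1 ↦
    ⟨eulerF_pos_s17 h0.le h1, eulerF_pos_s17 (by positivity) (pow_lt_one₀ h0.le h1 (by norm_num))⟩
  have hsub := intervalIntegral.integral_comp_mul_deriv_of_deriv_nonpos
    (g := fun x : ℝ ↦ x ^ (k - 1) / √(5 + 2 * x + x ^ 2))
    (fun q hq ↦ (hd q hq).continuousAt.continuousWithinAt)
    (fun q hq ↦ (hd q (Set.Ioo_subset_Icc_self hq)))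
    (fun q hq ↦ by
      obtain ⟨h0, h1⟩ := hmem q (Set.Ioo_subset_Icc_self hq)
      obtain ⟨hF1, hF5⟩ := hF q h0 h1
      exact neg_nonpos.2 (by positivity))
  rw [← hsub, ← intervalIntegral.integral_const_mul]
  refine intervalIntegral.integral_congr fun q hq ↦ ?_
  obtain ⟨h0, h1⟩ := hmem q hq
  obtain ⟨hF1, hF5⟩ := hF q h0 h1
  have hy := yF_pos h0 h1
  have hr : 0 < eulerF (q ^ ((1 : ℝ) / 5)) :=
    eulerF_pos_s17 (by positivity) (Real.rpow_lt_one h0.le h1 (by norm_num))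
  have hs : 0 < √(5 + 2 * yF q + yF q ^ 2) := Real.sqrt_pos.2 (by positivity)
  have hq4 : q ^ (-(4 : ℝ) / 5) = q ^ ((1 : ℝ) / 5) / q := by
    rw [← Real.rpow_sub_one h0.ne']; norm_num
  have hyF : eulerF (q ^ ((1 : ℝ) / 5)) = yF q * (q ^ ((1 : ℝ) / 5) * eulerF (q ^ 5)) := by
    rw [yF, div_mul_cancel₀ _ (by positivity)]
  have hp : 0 < q ^ ((1 : ℝ) / 5) := by positivity
  simp only [Function.comp]
  rw [Real.rpow_sub_one hy.ne', hq4, hyF]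
  generalize q ^ ((1 : ℝ) / 5) = p at *
  field_simp
end
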